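/- arXiv:2107.06837 — 4 statements merged into one kernel-verified Lean document; each statement's English description precedes it below -/
import Mathlib

section
/- For every integer n ≥ 1, M^{Irr}_{2n+32} ≥ M_n and M^{Irr}_{2n+35} ≥ M_n. -/
open Filter

/-- `x` lies strictly between `p` and `q`. -/
def StrictlyBetween (p q x : ℕ) : Prop := min p q < x ∧ x < max p q

/-- Two arcs `{p, q}` and `{r, s}` cross if exactly one of `r`, `s` lies strictly
between `p` and `q`. -/
def ArcsCross (p q r s : ℕ) : Prop :=
  Xor' (StrictlyBetween p q r) (StrictlyBetween p q s)

/-- `a` (with one-based indexing, only the values `a 1, …, a n` being relevant)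
is an open meandric permutation of order `n`: it is a permutation of `{1, …, n}`
with `a i ≡ i (mod 2)`, whose upper arcs (pairs `{a i, a (i+1)}` for odd `i < n`)
are pairwise noncrossing, whose lower arcs (pairs `{a i, a (i+1)}` for even
`1 ≤ i < n`) are pairwise noncrossing, such that no lower arc strictly encloses
`a 1`, and no lower arc (if `n` is even) resp. upper arc (if `n` is odd)
strictly encloses `a n`. -/
def IsOpenMeandricPerm (n : ℕ) (a : ℕ → ℕ) : Prop :=
  1 ≤ n ∧
  (∀ i, 1 ≤ i → i ≤ n → 1 ≤ a i ∧ a i ≤ n) ∧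
  (∀ i j, 1 ≤ i → i ≤ n → 1 ≤ j → j ≤ n → a i = a j → i = j) ∧
  (∀ i, 1 ≤ i → i ≤ n → a i % 2 = i % 2) ∧
  (∀ i j, Odd i → i < n → Odd j → j < n →
      ¬ ArcsCross (a i) (a (i + 1)) (a j) (a (j + 1))) ∧
  (∀ i j, Even i → 1 ≤ i → i < n → Even j → 1 ≤ j → j < n →
      ¬ ArcsCross (a i) (a (i + 1)) (a j) (a (j + 1))) ∧
  (∀ i, Even i → 1 ≤ i → i < n → ¬ StrictlyBetween (a i) (a (i + 1)) (a 1)) ∧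
  (if Even n
    then ∀ i, Even i → 1 ≤ i → i < n → ¬ StrictlyBetween (a i) (a (i + 1)) (a n)
    else ∀ i, Odd i → i < n → ¬ StrictlyBetween (a i) (a (i + 1)) (a n))

/-- An open meandric permutation of order `n` is irreducible if there are no
indices `1 ≤ k₁ < k₂ ≤ n` with `2 < k₂ - k₁ ≤ n - 2` such that the values
`a k₁, …, a k₂` form an interval of integers, i.e. their max minus their min
equals `k₂ - k₁`. -/
def IsIrreducibleMeander (n : ℕ) (a : ℕ → ℕ) : Prop :=
  ¬ ∃ k₁ k₂ : ℕ, ∃ h : k₁ < k₂, 1 ≤ k₁ ∧ k₂ ≤ n ∧ 2 < k₂ - k₁ ∧ k₂ - k₁ ≤ n - 2 ∧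
    (Finset.Icc k₁ k₂).sup' (Finset.nonempty_Icc.mpr h.le) a -
      (Finset.Icc k₁ k₂).inf' (Finset.nonempty_Icc.mpr h.le) a = k₂ - k₁

/-- An open meandric permutation of order `n` is prime if `a 1 ≠ 1` and no proper
initial segment `a 1, …, a j` (`2 ≤ j < n`) is a permutation of `{1, …, j}`. -/
def IsPrimeMeander (n : ℕ) (a : ℕ → ℕ) : Prop :=
  a 1 ≠ 1 ∧ ¬ ∃ j, 2 ≤ j ∧ j < n ∧ (Finset.Icc 1 j).image a = Finset.Icc 1 j

/-- `a` (with one-based indexing) is a closed meandric permutation of order `n`: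
a permutation of `{1, …, 2n}` with `a 1 = 1`, `a i ≡ i (mod 2)`, pairwise
noncrossing upper arcs `{a i, a (i+1)}` (odd `i < 2n`) and pairwise noncrossing
lower arcs, the latter being the `{a i, a (i+1)}` for even `1 ≤ i < 2n` together
with the wrap-around arc `{a (2n), a 1}`. -/
def IsClosedMeandricPerm (n : ℕ) (a : ℕ → ℕ) : Prop :=
  1 ≤ n ∧ a 1 = 1 ∧
  (∀ i, 1 ≤ i → i ≤ 2 * n → 1 ≤ a i ∧ a i ≤ 2 * n) ∧
  (∀ i j, 1 ≤ i → i ≤ 2 * n → 1 ≤ j → j ≤ 2 * n → a i = a j → i = j) ∧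
  (∀ i, 1 ≤ i → i ≤ 2 * n → a i % 2 = i % 2) ∧
  (∀ i j, Odd i → i < 2 * n → Odd j → j < 2 * n →
      ¬ ArcsCross (a i) (a (i + 1)) (a j) (a (j + 1))) ∧
  (∀ i j, Even i → 1 ≤ i → i < 2 * n → Even j → 1 ≤ j → j < 2 * n →
      ¬ ArcsCross (a i) (a (i + 1)) (a j) (a (j + 1))) ∧
  (∀ i, Even i → 1 ≤ i → i < 2 * n →
      ¬ ArcsCross (a i) (a (i + 1)) (a (2 * n)) (a 1) ∧
      ¬ ArcsCross (a (2 * n)) (a 1) (a i) (a (i + 1)))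

/-- `M n`: the number of open meandric permutations of order `n` (each counted
once via the normalization `a i = 0` outside `{1, …, n}`). -/
noncomputable def openMeanderCount (n : ℕ) : ℕ :=
  Set.ncard {a : ℕ → ℕ | IsOpenMeandricPerm n a ∧ ∀ i, i < 1 ∨ n < i → a i = 0}

/-- `M^{Irr} n`: the number of irreducible open meandric permutations of order `n`. -/
noncomputable def irrMeanderCount (n : ℕ) : ℕ :=
  Set.ncard {a : ℕ → ℕ | IsOpenMeandricPerm n a ∧ IsIrreducibleMeander n a ∧
    ∀ i, i < 1 ∨ n < i → a i = 0}

/-- `M^{(P)} n`: the number of prime open meandric permutations of order `n`. -/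
noncomputable def primeMeanderCount (n : ℕ) : ℕ :=
  Set.ncard {a : ℕ → ℕ | IsOpenMeandricPerm n a ∧ IsPrimeMeander n a ∧
    ∀ i, i < 1 ∨ n < i → a i = 0}

/-- `M̄ n`: the number of closed meandric permutations of order `n`. -/
noncomputable def closedMeanderCount (n : ℕ) : ℕ :=
  Set.ncard {a : ℕ → ℕ | IsClosedMeandricPerm n a ∧ ∀ i, i < 1 ∨ 2 * n < i → a i = 0}

namespace OpenMeander

instance (p q x : ℕ) : Decidable (StrictlyBetween p q x) :=
  inferInstanceAs (Decidable (_ ∧ _))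

instance (p q r s : ℕ) : Decidable (ArcsCross p q r s) :=
  inferInstanceAs (Decidable ((_ ∧ ¬ _) ∨ (_ ∧ ¬ _)))

/-- An open meander of order `K` in which the adjacent crossings `p, p + 1` are the `i`-th and the
`j`-th crossing along the curve, and whose curve crosses the line on both sides of them in
between. The condition `spread` expresses irreducibility. -/
structure IsSeed (K : ℕ) (c : ℕ → ℕ) (p i j : ℕ) : Prop where
  meandric : IsOpenMeandricPerm K c
  eq_zero : ∀ k, k < 1 ∨ K < k → c k = 0
  spread : ∀ k₁ k₂, 1 ≤ k₁ → k₁ + 2 < k₂ → k₂ ≤ K → k₂ + 2 ≤ k₁ + K →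
    ∃ x y, (k₁ ≤ x ∧ x ≤ k₂) ∧ (k₁ ≤ y ∧ y ≤ k₂) ∧ c x + (k₂ - k₁) < c y
  odd_left : p % 2 = 1
  one_lt : 1 < i
  lt : i < j
  lt_order : j < K
  eq_left : c i = p
  eq_right : c j = p + 1
  exists_below : ∃ k, i < k ∧ k < j ∧ c k < p
  exists_above : ∃ k, i < k ∧ k < j ∧ p + 1 < c k

theorem isOpenMeandricPerm_of_bounded {n : ℕ} {a : ℕ → ℕ} (hn : 1 ≤ n)
    (hrange : ∀ i < n + 1, 1 ≤ i → 1 ≤ a i ∧ a i ≤ n)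
    (hinj : ∀ i < n + 1, ∀ j < n + 1, 1 ≤ i → 1 ≤ j → a i = a j → i = j)
    (hpar : ∀ i < n + 1, 1 ≤ i → a i % 2 = i % 2)
    (hcross : ∀ i < n, ∀ j < n, 1 ≤ i → 1 ≤ j → i % 2 = j % 2 →
      ¬ ArcsCross (a i) (a (i + 1)) (a j) (a (j + 1)))
    (hfirst : ∀ i < n, 1 ≤ i → i % 2 = 0 → ¬ StrictlyBetween (a i) (a (i + 1)) (a 1))
    (hlast : ∀ i < n, 1 ≤ i → i % 2 = n % 2 → ¬ StrictlyBetween (a i) (a (i + 1)) (a n)) :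
    IsOpenMeandricPerm n a := by
  refine ⟨hn, fun i h1 h2 => hrange i (by omega) h1,
    fun i j h1 h2 h3 h4 => hinj i (by omega) j (by omega) h1 h3,
    fun i h1 h2 => hpar i (by omega) h1, ?_, ?_, ?_, ?_⟩
  · intro i j hi hin hj hjn
    rw [Nat.odd_iff] at hi hj
    exact hcross i hin j hjn (by omega) (by omega) (by omega)
  · intro i j hi h1 hin hj h2 hjn
    rw [Nat.even_iff] at hi hj
    exact hcross i hin j hjn h1 h2 (by omega)
  · intro i hi h1 hin
    rw [Nat.even_iff] at hi
    exact hfirst i hin h1 hi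
  · split_ifs with h
    · intro i hi h1 hin
      rw [Nat.even_iff] at hi h
      exact hlast i hin h1 (by omega)
    · intro i hi hin
      rw [Nat.odd_iff] at hi
      rw [Nat.even_iff] at h
      exact hlast i hin (by omega) (by omega)

/-- The sequence with entries `l` at the indices `1, …, l.length`, and `0` elsewhere. -/
def ofList (l : List ℕ) (k : ℕ) : ℕ := (0 :: l).getD k 0

theorem ofList_eq_zero {l : List ℕ} {k : ℕ} (hk : k < 1 ∨ l.length < k) : ofList l k = 0 := by
  rcases hk with hk | hk
  · obtain rfl : k = 0 := by omega
    rfl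
  · exact List.getD_eq_default _ _ (by simpa using hk)

/-- A decidable form of `IsSeed` for sequences given by a list. -/
def SeedCheck (l : List ℕ) (p i j lo hi : ℕ) : Prop :=
  (1 ≤ l.length ∧
    (∀ x < l.length + 1, 1 ≤ x → 1 ≤ ofList l x ∧ ofList l x ≤ l.length) ∧
    (∀ x < l.length + 1, ∀ y < l.length + 1, 1 ≤ x → 1 ≤ y → ofList l x = ofList l y → x = y) ∧
    (∀ x < l.length + 1, 1 ≤ x → ofList l x % 2 = x % 2) ∧
    (∀ x < l.length, ∀ y < l.length, 1 ≤ x → 1 ≤ y → x % 2 = y % 2 →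
      ¬ ArcsCross (ofList l x) (ofList l (x + 1)) (ofList l y) (ofList l (y + 1))) ∧
    (∀ x < l.length, 1 ≤ x → x % 2 = 0 →
      ¬ StrictlyBetween (ofList l x) (ofList l (x + 1)) (ofList l 1)) ∧
    (∀ x < l.length, 1 ≤ x → x % 2 = l.length % 2 →
      ¬ StrictlyBetween (ofList l x) (ofList l (x + 1)) (ofList l l.length))) ∧
  (∀ k₁ < l.length + 1, ∀ k₂ < l.length + 1, 1 ≤ k₁ → k₁ + 2 < k₂ → k₂ + 2 ≤ k₁ + l.length →
    k₂ - k₁ + l.length <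
      (Finset.Icc k₁ k₂).sup (fun x => l.length - ofList l x) +
        (Finset.Icc k₁ k₂).sup (ofList l)) ∧
  (p % 2 = 1 ∧ 1 < i ∧ i < j ∧ j < l.length ∧ ofList l i = p ∧ ofList l j = p + 1) ∧
  (i < lo ∧ lo < j ∧ ofList l lo < p) ∧ (i < hi ∧ hi < j ∧ p + 1 < ofList l hi)

set_option synthInstance.maxHeartbeats 400000 in
set_option synthInstance.maxSize 2000 in
instance (l : List ℕ) (p i j lo hi : ℕ) : Decidable (SeedCheck l p i j lo hi) := by
  unfold SeedCheck
  infer_instance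

theorem SeedCheck.isSeed {l : List ℕ} {p i j lo hi : ℕ} (h : SeedCheck l p i j lo hi) :
    IsSeed l.length (ofList l) p i j := by
  obtain ⟨⟨h1, h2, h3, h4, h5, h6, h7⟩, hs, ⟨g1, g2, g3, g4, g5, g6⟩, hlo, hhi⟩ := h
  refine ⟨isOpenMeandricPerm_of_bounded h1 h2 h3 h4 h5 h6 h7, fun k => ofList_eq_zero, ?_,
    g1, g2, g3, g4, g5, g6, ⟨lo, hlo⟩, ⟨hi, hhi⟩⟩
  intro k₁ k₂ e1 e2 e3 e4
  have hne : (Finset.Icc k₁ k₂).Nonempty := Finset.nonempty_Icc.mpr (by omega)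
  obtain ⟨x, hx, e5⟩ := Finset.exists_mem_eq_sup _ hne (fun x => l.length - ofList l x)
  obtain ⟨y, hy, e6⟩ := Finset.exists_mem_eq_sup _ hne (ofList l)
  have e7 := hs k₁ (by omega) k₂ (by omega) e1 e2 e4
  rw [e5, e6] at e7
  rw [Finset.mem_Icc] at hx hy
  have e8 := h2 y (by omega) (by omega)
  exact ⟨x, y, hx, hy, by omega⟩

theorem exists_isSeed_32 : ∃ c p i j, IsSeed 32 c p i j :=
  ⟨_, _, _, _, SeedCheck.isSeed (l :=
    [19, 18, 3, 24, 27, 28, 23, 14, 13, 4, 7, 10, 11, 6, 5, 12, 15, 22, 31, 30, 29, 26, 25, 2,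
    1, 32, 21, 16, 9, 8, 17, 20])
    (p := 7) (i := 11) (j := 30) (lo := 14) (hi := 12) (by decide +kernel)⟩

theorem exists_isSeed_34 : ∃ c p i j, IsSeed 34 c p i j :=
  ⟨_, _, _, _, SeedCheck.isSeed (l :=
    [7, 24, 27, 4, 3, 28, 23, 8, 11, 14, 15, 10, 9, 20, 19, 16, 31, 30, 17, 18, 21, 22, 29, 32,
    33, 2, 5, 26, 25, 6, 1, 34, 13, 12])
    (p := 15) (i := 11) (j := 16) (lo := 12) (hi := 14) (by decide +kernel)⟩

theorem exists_isSeed_35 : ∃ c p i j, IsSeed 35 c p i j :=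
  ⟨_, _, _, _, SeedCheck.isSeed (l :=
    [19, 8, 13, 12, 9, 18, 17, 16, 1, 4, 5, 26, 25, 6, 3, 2, 15, 10, 11, 14, 7, 20, 35, 30, 31,
    34, 21, 24, 27, 28, 23, 22, 33, 32, 29])
    (p := 9) (i := 5) (j := 18) (lo := 9) (hi := 6) (by decide +kernel)⟩

theorem exists_isSeed_37 : ∃ c p i j, IsSeed 37 c p i j :=
  ⟨_, _, _, _, SeedCheck.isSeed (l :=
    [21, 6, 11, 14, 17, 18, 13, 12, 3, 30, 31, 2, 19, 8, 9, 16, 15, 10, 7, 20, 1, 32, 29, 24,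
    23, 4, 5, 22, 37, 34, 27, 26, 35, 36, 25, 28, 33])
    (p := 3) (i := 9) (j := 26) (lo := 12) (hi := 10) (by decide +kernel)⟩

theorem not_arcsCross_iff {u w s t : ℕ} :
    ¬ ArcsCross u w s t ↔ (StrictlyBetween u w s ↔ StrictlyBetween u w t) := by
  change ¬ (_ ∧ ¬ _ ∨ _ ∧ ¬ _) ↔ _
  tauto

theorem not_arcsCross_self (u w : ℕ) : ¬ ArcsCross u w u w := by
  rw [not_arcsCross_iff]
  simp only [StrictlyBetween]
  omega

theorem not_arcsCross_of_sameSide {u w s t : ℕ}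
    (hs : s < u ∧ s < w ∨ u < s ∧ w < s) (ht : t < u ∧ t < w ∨ u < t ∧ w < t) :
    ¬ ArcsCross u w s t ∧ ¬ ArcsCross s t u w := by
  rw [not_arcsCross_iff, not_arcsCross_iff]
  simp only [StrictlyBetween]
  omega

theorem arcsCross_comm_left {u w s t : ℕ} : ArcsCross u w s t ↔ ArcsCross w u s t := by
  simp only [ArcsCross, StrictlyBetween, min_comm, max_comm]

theorem arcsCross_comm_right {u w s t : ℕ} : ArcsCross u w s t ↔ ArcsCross u w t s := by
  rw [← not_iff_not, not_arcsCross_iff, not_arcsCross_iff]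
  exact iff_comm

/-- The map of positions on the line that replaces the positions `p, p + 1` by a block of length
`2 * n`, moving `p` and `p + 1` by `q`. -/
def stretch (n p q v : ℕ) : ℕ :=
  if v < p then v else if v ≤ p + 1 then v + q else v + 2 * n - 2

theorem stretch_lt_stretch {n p q u v : ℕ} (hq : q + 2 ≤ 2 * n) :
    stretch n p q u < stretch n p q v ↔ u < v := by
  unfold stretch
  split_ifs <;> omega

theorem strictlyBetween_stretch {n p q u w v : ℕ} (hq : q + 2 ≤ 2 * n) :
    StrictlyBetween (stretch n p q u) (stretch n p q w) (stretch n p q v) ↔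
      StrictlyBetween u w v := by
  simp only [StrictlyBetween, min_lt_iff, lt_max_iff, stretch_lt_stretch hq]

theorem arcsCross_stretch {n p q u w s t : ℕ} (hq : q + 2 ≤ 2 * n) :
    ArcsCross (stretch n p q u) (stretch n p q w) (stretch n p q s) (stretch n p q t) ↔
      ArcsCross u w s t := by
  simp only [ArcsCross, strictlyBetween_stretch hq]

/-- The positions of the left one of two parallel copies of the curve `a`, in a block starting
at `p`. -/
def leftStrand (p : ℕ) (a : ℕ → ℕ) (r : ℕ) : ℕ := p + 2 * a r - 1 - r % 2

/-- The positions of the right one of two parallel copies of the curve `a`, in a block starting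
at `p`. -/
def rightStrand (p : ℕ) (a : ℕ → ℕ) (r : ℕ) : ℕ := p + 2 * a r - 2 + r % 2

/-- The curve obtained from `c` by replacing its `i`-th and `j`-th crossing, at positions `p` and
`p + 1`, by two parallel copies of the curve `a` of order `n`, the second one run backwards. -/
def cable (n p i j : ℕ) (c a : ℕ → ℕ) (x : ℕ) : ℕ :=
  if x < i then stretch n p 0 (c x)
  else if x < i + n then leftStrand p a (x + 1 - i)
  else if x + 1 < j + n then stretch n p 0 (c (x + 1 - n))
  else if x + 1 < j + 2 * n then rightStrand p a (j + 2 * n - 1 - x)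
  else stretch n p 0 (c (x + 2 - 2 * n))

theorem _root_.IsOpenMeandricPerm.not_arcsCross {n : ℕ} {a : ℕ → ℕ} (h : IsOpenMeandricPerm n a)
    {x y : ℕ} (hx : 1 ≤ x) (hxn : x < n) (hy : 1 ≤ y) (hyn : y < n) (hxy : x % 2 = y % 2) :
    ¬ ArcsCross (a x) (a (x + 1)) (a y) (a (y + 1)) := by
  obtain ⟨-, -, -, -, h5, h6, -, -⟩ := h
  rcases Nat.even_or_odd x with hx' | hx'
  · have hy' : Even y := by rw [Nat.even_iff] at *; omega
    exact h6 x y hx' hx hxn hy' hy hyn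
  · have hy' : Odd y := by rw [Nat.odd_iff] at *; omega
    exact h5 x y hx' hxn hy' hyn

theorem _root_.IsOpenMeandricPerm.first_exposed {n : ℕ} {a : ℕ → ℕ} (h : IsOpenMeandricPerm n a)
    {x : ℕ} (hx : 1 ≤ x) (hxn : x < n) (hx2 : x % 2 = 0) :
    ¬ StrictlyBetween (a x) (a (x + 1)) (a 1) :=
  h.2.2.2.2.2.2.1 x (Nat.even_iff.mpr hx2) hx hxn

theorem _root_.IsOpenMeandricPerm.last_exposed {n : ℕ} {a : ℕ → ℕ} (h : IsOpenMeandricPerm n a)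
    {x : ℕ} (hx : 1 ≤ x) (hxn : x < n) (hx2 : x % 2 = n % 2) :
    ¬ StrictlyBetween (a x) (a (x + 1)) (a n) := by
  have h8 := h.2.2.2.2.2.2.2
  split_ifs at h8 with hn
  · rw [Nat.even_iff] at hn
    exact h8 x (Nat.even_iff.mpr (by omega)) hx hxn
  · rw [Nat.even_iff] at hn
    exact h8 x (Nat.odd_iff.mpr (by omega)) hxn

section Cable

variable {K n p i j : ℕ} {c a : ℕ → ℕ}

theorem cable_of_lt {x : ℕ} (hx : x < i) : cable n p i j c a x = stretch n p 0 (c x) :=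
  if_pos hx

theorem cable_left {x r : ℕ} (hr : 1 ≤ r) (hrn : r ≤ n) (hx : x + 1 = i + r) :
    cable n p i j c a x = leftStrand p a r := by
  obtain rfl : r = x + 1 - i := by omega
  rw [cable, if_neg (by omega), if_pos (by omega)]

theorem cable_between {x k : ℕ} (hik : i < k) (hkj : k < j) (hx : x + 1 = k + n) :
    cable n p i j c a x = stretch n p 0 (c k) := by
  obtain rfl : k = x + 1 - n := by omega
  rw [cable, if_neg (by omega), if_neg (by omega), if_pos (by omega)]

theorem cable_right (hij : i < j) {x r : ℕ} (hr : 1 ≤ r) (hrn : r ≤ n)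
    (hx : x + r + 1 = j + 2 * n) :
    cable n p i j c a x = rightStrand p a r := by
  obtain rfl : r = j + 2 * n - 1 - x := by omega
  rw [cable, if_neg (by omega), if_neg (by omega), if_neg (by omega), if_pos (by omega)]

theorem cable_of_gt (hij : i < j) {x k : ℕ} (hjk : j < k) (hx : x + 2 = k + 2 * n) :
    cable n p i j c a x = stretch n p 0 (c k) := by
  obtain rfl : k = x + 2 - 2 * n := by omega
  rw [cable, if_neg (by omega), if_neg (by omega), if_neg (by omega), if_neg (by omega)]

namespace IsSeed

theorem index_eq (hc : IsSeed K c p i j) {k l : ℕ} (hk : 1 ≤ k) (hkK : k ≤ K) (hl : 1 ≤ l)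
    (hlK : l ≤ K) (h : c k = c l) : k = l :=
  hc.meandric.2.2.1 k l hk hkK hl hlK h

theorem lt_or_gt (hc : IsSeed K c p i j) {k : ℕ} (hk : 1 ≤ k) (hkK : k ≤ K) (hi : k ≠ i)
    (hj : k ≠ j) : c k < p ∨ p + 1 < c k := by
  have h1 := hc.one_lt
  have h2 := hc.lt
  have h3 := hc.lt_order
  have h4 := hc.eq_left
  have h5 := hc.eq_right
  by_contra! h
  rcases (by omega : c k = p ∨ c k = p + 1) with h6 | h6
  · exact hi (hc.index_eq hk hkK (by omega) (by omega) (h6.trans h4.symm))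
  · exact hj (hc.index_eq hk hkK (by omega) (by omega) (h6.trans h5.symm))

theorem index_mod_two (hc : IsSeed K c p i j) : i % 2 = 1 ∧ j % 2 = 0 := by
  have h1 := hc.one_lt
  have h2 := hc.lt
  have h3 := hc.lt_order
  have h4 := hc.meandric.2.2.2.1 i (by omega) (by omega)
  have h5 := hc.meandric.2.2.2.1 j (by omega) (by omega)
  have h6 := hc.odd_left
  rw [hc.eq_left] at h4
  rw [hc.eq_right] at h5
  omega

theorem le_order (hc : IsSeed K c p i j) : 1 ≤ p ∧ p + 1 ≤ K := by
  have h1 := hc.one_lt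
  have h2 := hc.lt
  have h3 := hc.lt_order
  have h4 := hc.meandric.2.1 i (by omega) (by omega)
  have h5 := hc.meandric.2.1 j (by omega) (by omega)
  rw [hc.eq_left] at h4
  rw [hc.eq_right] at h5
  omega

theorem stretch_eq (hc : IsSeed K c p i j) {k : ℕ} (hk : 1 ≤ k) (hkK : k ≤ K) (hi : k ≠ i)
    (hj : k ≠ j) (q : ℕ) : stretch n p 0 (c k) = stretch n p q (c k) := by
  have := hc.lt_or_gt hk hkK hi hj
  unfold stretch
  split_ifs <;> omega

/-- Every crossing of a cabled curve comes from the seed or from one of the two copies. -/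
theorem cable_cases (hc : IsSeed K c p i j) {x : ℕ} (hx : 1 ≤ x) (hxN : x + 2 ≤ K + 2 * n) :
    (∃ k, 1 ≤ k ∧ k ≤ K ∧
        (k < i ∧ x = k ∨ i < k ∧ k < j ∧ x + 1 = k + n ∨ j < k ∧ x + 2 = k + 2 * n) ∧
        (c k < p ∧ cable n p i j c a x = c k ∨
          p + 1 < c k ∧ cable n p i j c a x = c k + 2 * n - 2)) ∨
      (∃ r, 1 ≤ r ∧ r ≤ n ∧ x + 1 = i + r ∧ cable n p i j c a x = leftStrand p a r) ∨
      ∃ r, 1 ≤ r ∧ r ≤ n ∧ x + r + 1 = j + 2 * n ∧ cable n p i j c a x = rightStrand p a r := by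
  have h1 := hc.one_lt
  have h2 := hc.lt
  have h3 := hc.lt_order
  have key : ∀ k, 1 ≤ k → k ≤ K → k ≠ i → k ≠ j →
      cable n p i j c a x = stretch n p 0 (c k) →
      (c k < p ∧ cable n p i j c a x = c k ∨
        p + 1 < c k ∧ cable n p i j c a x = c k + 2 * n - 2) := by
    intro k hk hkK hi hj h
    have := hc.lt_or_gt hk hkK hi hj
    rw [h]
    unfold stretch
    split_ifs <;> omega
  by_cases c1 : x < i
  · exact .inl ⟨x, by omega, by omega, by omega,
      key x (by omega) (by omega) (by omega) (by omega) (cable_of_lt c1)⟩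
  by_cases c2 : x < i + n
  · exact .inr (.inl ⟨x + 1 - i, by omega, by omega, by omega,
      cable_left (by omega) (by omega) (by omega)⟩)
  by_cases c3 : x + 1 < j + n
  · exact .inl ⟨x + 1 - n, by omega, by omega, by omega,
      key _ (by omega) (by omega) (by omega) (by omega)
        (cable_between (by omega) (by omega) (by omega))⟩
  by_cases c4 : x + 1 < j + 2 * n
  · exact .inr (.inr ⟨j + 2 * n - 1 - x, by omega, by omega, by omega,
      cable_right h2 (by omega) (by omega) (by omega)⟩)
  · exact .inl ⟨x + 2 - 2 * n, by omega, by omega, by omega,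
      key _ (by omega) (by omega) (by omega) (by omega)
        (cable_of_gt h2 (by omega) (by omega))⟩

/-- Every arc of a cabled curve comes from the seed or from one of the two copies. -/
theorem cable_arc_cases (hc : IsSeed K c p i j) (ha : IsOpenMeandricPerm n a) (hn : n % 2 = 1)
    {x : ℕ} (hx : 1 ≤ x) (hxN : x + 2 < K + 2 * n) :
    (∃ k, 1 ≤ k ∧ k < K ∧ k % 2 = x % 2 ∧
        cable n p i j c a x = stretch n p (2 * a (if x % 2 = 0 then 1 else n) - 2) (c k) ∧
        cable n p i j c a (x + 1) =
          stretch n p (2 * a (if x % 2 = 0 then 1 else n) - 2) (c (k + 1))) ∨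
      (∃ r, 1 ≤ r ∧ r < n ∧ r % 2 = x % 2 ∧ cable n p i j c a x = leftStrand p a r ∧
        cable n p i j c a (x + 1) = leftStrand p a (r + 1)) ∨
      ∃ r, 1 ≤ r ∧ r < n ∧ r % 2 = x % 2 ∧ cable n p i j c a x = rightStrand p a (r + 1) ∧
        cable n p i j c a (x + 1) = rightStrand p a r := by
  have h1 := hc.one_lt
  have h2 := hc.lt
  have h3 := hc.lt_order
  have h4 := hc.eq_left
  have h5 := hc.eq_right
  obtain ⟨h6, h7⟩ := hc.index_mod_two
  have hT : i + 2 < j := by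
    obtain ⟨k, hk⟩ := hc.exists_below
    omega
  have a1 := ha.2.1 1 le_rfl ha.1
  have an := ha.2.1 n ha.1 le_rfl
  have hp := hc.le_order
  have hleft : ∀ r, r % 2 = 1 → 1 ≤ a r → leftStrand p a r = stretch n p (2 * a r - 2) p := by
    intro r hr har
    rw [leftStrand, stretch, if_neg (by omega), if_pos (by omega)]
    omega
  have hright : ∀ r, r % 2 = 1 → 1 ≤ a r →
      rightStrand p a r = stretch n p (2 * a r - 2) (p + 1) := by
    intro r hr har
    rw [rightStrand, stretch, if_neg (by omega), if_pos (by omega)]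
    omega
  by_cases c1 : x + 1 < i
  · refine .inl ⟨x, by omega, by omega, rfl, ?_, ?_⟩
    · rw [cable_of_lt (by omega)]
      exact hc.stretch_eq (by omega) (by omega) (by omega) (by omega) _
    · rw [cable_of_lt (by omega)]
      exact hc.stretch_eq (by omega) (by omega) (by omega) (by omega) _
  by_cases c2 : x + 1 = i
  · refine .inl ⟨x, by omega, by omega, rfl, ?_, ?_⟩
    · rw [cable_of_lt (by omega)]
      exact hc.stretch_eq (by omega) (by omega) (by omega) (by omega) _
    · rw [if_pos (by omega), cable_left (r := 1) (by omega) (by omega) (by omega), c2, h4]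
      exact hleft 1 rfl a1.1
  by_cases c3 : x + 1 < i + n
  · exact .inr (.inl ⟨x + 1 - i, by omega, by omega, by omega,
      cable_left (by omega) (by omega) (by omega), cable_left (by omega) (by omega) (by omega)⟩)
  by_cases c4 : x + 1 = i + n
  · refine .inl ⟨i, by omega, by omega, by omega, ?_, ?_⟩
    · rw [if_neg (by omega), cable_left (r := n) (by omega) (by omega) (by omega), h4]
      exact hleft n hn an.1
    · rw [cable_between (k := i + 1) (by omega) (by omega) (by omega)]
      exact hc.stretch_eq (by omega) (by omega) (by omega) (by omega) _
  by_cases c5 : x + 2 < j + n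
  · refine .inl ⟨x + 1 - n, by omega, by omega, by omega, ?_, ?_⟩
    · rw [cable_between (k := x + 1 - n) (by omega) (by omega) (by omega)]
      exact hc.stretch_eq (by omega) (by omega) (by omega) (by omega) _
    · rw [cable_between (k := x + 1 - n + 1) (by omega) (by omega) (by omega)]
      exact hc.stretch_eq (by omega) (by omega) (by omega) (by omega) _
  by_cases c6 : x + 2 = j + n
  · refine .inl ⟨j - 1, by omega, by omega, by omega, ?_, ?_⟩
    · rw [cable_between (k := j - 1) (by omega) (by omega) (by omega)]
      exact hc.stretch_eq (by omega) (by omega) (by omega) (by omega) _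
    · rw [if_neg (by omega), cable_right (r := n) h2 (by omega) (by omega) (by omega),
        show j - 1 + 1 = j by omega, h5]
      exact hright n hn an.1
  by_cases c7 : x + 2 < j + 2 * n
  · exact .inr (.inr ⟨j + 2 * n - 2 - x, by omega, by omega, by omega,
      cable_right h2 (by omega) (by omega) (by omega),
      cable_right h2 (by omega) (by omega) (by omega)⟩)
  by_cases c8 : x + 2 = j + 2 * n
  · refine .inl ⟨j, by omega, by omega, by omega, ?_, ?_⟩
    · rw [if_pos (by omega), cable_right (r := 1) h2 (by omega) (by omega) (by omega), h5]
      exact hright 1 rfl a1.1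
    · rw [cable_of_gt (k := j + 1) h2 (by omega) (by omega)]
      exact hc.stretch_eq (by omega) (by omega) (by omega) (by omega) _
  · refine .inl ⟨x + 2 - 2 * n, by omega, by omega, by omega, ?_, ?_⟩
    · rw [cable_of_gt (k := x + 2 - 2 * n) h2 (by omega) (by omega)]
      exact hc.stretch_eq (by omega) (by omega) (by omega) (by omega) _
    · rw [cable_of_gt (k := x + 2 - 2 * n + 1) h2 (by omega) (by omega)]
      exact hc.stretch_eq (by omega) (by omega) (by omega) (by omega) _

theorem cable_inj (hc : IsSeed K c p i j) (ha : IsOpenMeandricPerm n a)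
    {x y : ℕ} (hx : 1 ≤ x) (hxN : x + 2 ≤ K + 2 * n) (hy : 1 ≤ y) (hyN : y + 2 ≤ K + 2 * n)
    (h : cable n p i j c a x = cable n p i j c a y) : x = y := by
  have hn := ha.1
  have hij := hc.lt
  have key : ∀ {r}, 1 ≤ r → r ≤ n → (p ≤ leftStrand p a r ∧ leftStrand p a r + 1 ≤ p + 2 * n ∧
      (leftStrand p a r + r) % 2 = (p + 1) % 2) ∧
      p ≤ rightStrand p a r ∧ rightStrand p a r + 1 ≤ p + 2 * n ∧
      (rightStrand p a r + r) % 2 = p % 2 := by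
    intro r hr hrn
    have := ha.2.1 r hr hrn
    have := hc.le_order
    unfold leftStrand rightStrand
    omega
  have key2 : ∀ {r s}, 1 ≤ r → r ≤ n → 1 ≤ s → s ≤ n →
      (leftStrand p a r = leftStrand p a s → r = s) ∧
      (rightStrand p a r = rightStrand p a s → r = s) ∧
      leftStrand p a r ≠ rightStrand p a s := by
    intro r s hr hrn hs hsn
    have h1 := ha.2.2.1 r s hr hrn hs hsn
    have := ha.2.1 r hr hrn
    have := ha.2.1 s hs hsn
    have := ha.2.2.2.1 r hr hrn
    have := ha.2.2.2.1 s hs hsn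
    have := hc.le_order
    unfold leftStrand rightStrand
    refine ⟨fun h => h1 (by omega), fun h => h1 (by omega), fun h => ?_⟩
    have := h1 (by omega)
    subst this
    omega
  rcases hc.cable_cases (a := a) hx hxN with
    ⟨k, hk, hkK, hkx, hkv⟩ | ⟨k, hk, hkK, hkx, hkv⟩ | ⟨k, hk, hkK, hkx, hkv⟩ <;>
  rcases hc.cable_cases (a := a) hy hyN with
    ⟨l, hl, hlK, hlx, hlv⟩ | ⟨l, hl, hlK, hlx, hlv⟩ | ⟨l, hl, hlK, hlx, hlv⟩
  · have := hc.index_eq hk hkK hl hlK (by omega)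
    omega
  · have := key hl hlK
    omega
  · have := key hl hlK
    omega
  · have := key hk hkK
    omega
  · have := (key2 hk hkK hl hlK).1 (by omega)
    omega
  · have := (key2 hk hkK hl hlK).2.2
    omega
  · have := key hk hkK
    omega
  · have := (key2 hl hlK hk hkK).2.2
    omega
  · have := (key2 hk hkK hl hlK).2.1 (by omega)
    omega

theorem not_arcsCross_strand {A B C D e f g h : ℕ} (hp : 1 ≤ p) (hA : 1 ≤ A) (hB : 1 ≤ B)
    (hC : 1 ≤ C) (hD : 1 ≤ D) (hAC : A ≠ C) (hAD : A ≠ D) (hBC : B ≠ C) (hBD : B ≠ D)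
    (he : e ≤ 1) (hf : f ≤ 1) (hg : g ≤ 1) (hh : h ≤ 1) (hcr : ¬ ArcsCross A B C D) :
    ¬ ArcsCross (p + 2 * A - 2 + e) (p + 2 * B - 2 + f) (p + 2 * C - 2 + g)
      (p + 2 * D - 2 + h) := by
  have key : ∀ {X Y e f : ℕ}, 1 ≤ X → 1 ≤ Y → X ≠ Y → e ≤ 1 → f ≤ 1 →
      (p + 2 * X - 2 + e < p + 2 * Y - 2 + f ↔ X < Y) := by
    intro X Y e f _ _ _ _ _
    omega
  rw [not_arcsCross_iff] at hcr ⊢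
  simpa only [StrictlyBetween, min_lt_iff, lt_max_iff, key hA hC hAC he hg, key hB hC hBC hf hg,
    key hA hD hAD he hh, key hB hD hBD hf hh, key hC hA hAC.symm hg he, key hC hB hBC.symm hg hf,
    key hD hA hAD.symm hh he, key hD hB hBD.symm hh hf] using hcr

theorem cable_not_arcsCross (hc : IsSeed K c p i j) (ha : IsOpenMeandricPerm n a)
    (hn : n % 2 = 1) {x y : ℕ} (hx : 1 ≤ x) (hxN : x + 2 < K + 2 * n) (hy : 1 ≤ y)
    (hyN : y + 2 < K + 2 * n) (hxy : x % 2 = y % 2) :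
    ¬ ArcsCross (cable n p i j c a x) (cable n p i j c a (x + 1)) (cable n p i j c a y)
      (cable n p i j c a (y + 1)) := by
  have hp := hc.le_order
  have hrange : ∀ r, 1 ≤ r → r ≤ n → 1 ≤ a r ∧ a r ≤ n := ha.2.1
  have hne : ∀ {r s}, 1 ≤ r → r ≤ n → 1 ≤ s → s ≤ n → r ≠ s → a r ≠ a s :=
    fun hr hrn hs hsn h h' => h (ha.2.2.1 _ _ hr hrn hs hsn h')
  have hl : ∀ {r}, 1 ≤ r → r ≤ n → leftStrand p a r = p + 2 * a r - 2 + (1 - r % 2) := by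
    intro r hr hrn
    have := hrange r hr hrn
    unfold leftStrand
    omega
  have hr' : ∀ r, rightStrand p a r = p + 2 * a r - 2 + r % 2 := fun r => rfl
  have hcopies : ∀ {r s e f g h : ℕ}, 1 ≤ r → r < n → 1 ≤ s → s < n → r % 2 = s % 2 → r ≠ s →
      e ≤ 1 → f ≤ 1 → g ≤ 1 → h ≤ 1 →
      ¬ ArcsCross (p + 2 * a r - 2 + e) (p + 2 * a (r + 1) - 2 + f) (p + 2 * a s - 2 + g)
        (p + 2 * a (s + 1) - 2 + h) := by
    intro r s e f g h hr hrn hs hsn hrs hrs' he hf hg hh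
    exact not_arcsCross_strand hp.1 (hrange _ hr hrn.le).1 (hrange _ (by omega) (by omega)).1
      (hrange _ hs hsn.le).1 (hrange _ (by omega) (by omega)).1
      (hne hr hrn.le hs hsn.le hrs') (hne hr hrn.le (by omega) (by omega) (by omega))
      (hne (by omega) (by omega) hs hsn.le (by omega))
      (hne (by omega) (by omega) (by omega) (by omega) (by omega)) he hf hg hh
      (ha.not_arcsCross hr hrn hs hsn hrs)
  have hparallel : ∀ {r : ℕ}, 1 ≤ r → r < n →
      ¬ ArcsCross (leftStrand p a r) (leftStrand p a (r + 1)) (rightStrand p a (r + 1))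
        (rightStrand p a r) ∧
      ¬ ArcsCross (rightStrand p a (r + 1)) (rightStrand p a r) (leftStrand p a r)
        (leftStrand p a (r + 1)) := by
    intro r hr hrn
    have h1 := hrange r hr hrn.le
    have h2 := hrange (r + 1) (by omega) hrn
    have h3 := hne (s := r + 1) hr hrn.le (by omega) hrn (by omega)
    rw [hl hr hrn.le, hl (r := r + 1) (by omega) hrn, hr', hr', not_arcsCross_iff,
      not_arcsCross_iff]
    simp only [StrictlyBetween]
    omega
  have hside : ∀ {v r e f : ℕ}, 1 ≤ r → r < n → r % 2 = x % 2 → e ≤ 1 → f ≤ 1 →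
      (stretch n p (2 * a (if x % 2 = 0 then 1 else n) - 2) v < p + 2 * a r - 2 + e ∧
        stretch n p (2 * a (if x % 2 = 0 then 1 else n) - 2) v < p + 2 * a (r + 1) - 2 + f) ∨
      (p + 2 * a r - 2 + e < stretch n p (2 * a (if x % 2 = 0 then 1 else n) - 2) v ∧
        p + 2 * a (r + 1) - 2 + f < stretch n p (2 * a (if x % 2 = 0 then 1 else n) - 2) v) := by
    intro v r e f hr hrn hrx he hf
    have h1 := hrange r hr hrn.le
    have h2 := hrange (r + 1) (by omega) (by omega)
    have h3 : ¬ StrictlyBetween (a r) (a (r + 1)) (a (if x % 2 = 0 then 1 else n)) := by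
      split_ifs with h
      · exact ha.first_exposed hr hrn (by omega)
      · exact ha.last_exposed hr hrn (by omega)
    have h4 : a r ≠ a (if x % 2 = 0 then 1 else n) :=
      hne hr hrn.le (by split_ifs <;> omega) (by split_ifs <;> omega) (by split_ifs <;> omega)
    have h5 : a (r + 1) ≠ a (if x % 2 = 0 then 1 else n) :=
      hne (by omega) hrn (by split_ifs <;> omega) (by split_ifs <;> omega)
        (by split_ifs <;> omega)
    have h6 : 1 ≤ a (if x % 2 = 0 then 1 else n) ∧ a (if x % 2 = 0 then 1 else n) ≤ n :=
      hrange _ (by split_ifs <;> omega) (by split_ifs <;> omega)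
    generalize a (if x % 2 = 0 then 1 else n) = s at *
    simp only [StrictlyBetween] at h3
    unfold stretch
    split_ifs <;> omega
  have hq : 2 * a (if x % 2 = 0 then 1 else n) - 2 + 2 ≤ 2 * n := by
    have := ha.1
    have := hrange (if x % 2 = 0 then 1 else n) (by split_ifs <;> omega) (by split_ifs <;> omega)
    omega
  have hside' : ∀ {v r e f : ℕ}, 1 ≤ r → r < n → r % 2 = x % 2 → e ≤ 1 → f ≤ 1 →
      (stretch n p (2 * a (if x % 2 = 0 then 1 else n) - 2) v < p + 2 * a (r + 1) - 2 + e ∧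
        stretch n p (2 * a (if x % 2 = 0 then 1 else n) - 2) v < p + 2 * a r - 2 + f) ∨
      (p + 2 * a (r + 1) - 2 + e < stretch n p (2 * a (if x % 2 = 0 then 1 else n) - 2) v ∧
        p + 2 * a r - 2 + f < stretch n p (2 * a (if x % 2 = 0 then 1 else n) - 2) v) :=
    fun hr hrn hrx he hf => (hside hr hrn hrx hf he).imp And.symm And.symm
  rcases hc.cable_arc_cases ha hn hx hxN with
    ⟨k, hk, hkK, hkx, e1, e2⟩ | ⟨k, hk, hkK, hkx, e1, e2⟩ | ⟨k, hk, hkK, hkx, e1, e2⟩ <;>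
  rcases hc.cable_arc_cases ha hn hy hyN with
    ⟨l, hl1, hlK, hly, e3, e4⟩ | ⟨l, hl1, hlK, hly, e3, e4⟩ | ⟨l, hl1, hlK, hly, e3, e4⟩ <;>
  rw [← hxy] at * <;> rw [e1, e2, e3, e4]
  · rw [arcsCross_stretch hq]
    exact hc.meandric.not_arcsCross hk hkK hl1 hlK (by omega)
  · rw [hl hl1 hlK.le, hl (by omega) hlK]
    exact (not_arcsCross_of_sameSide (hside hl1 hlK hly (by omega) (by omega))
      (hside hl1 hlK hly (by omega) (by omega))).2
  · rw [hr', hr']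
    exact (not_arcsCross_of_sameSide (hside' hl1 hlK hly (by omega) (by omega))
      (hside' hl1 hlK hly (by omega) (by omega))).2
  · rw [hl hk hkK.le, hl (by omega) hkK]
    exact (not_arcsCross_of_sameSide (hside hk hkK hkx (by omega) (by omega))
      (hside hk hkK hkx (by omega) (by omega))).1
  · rcases eq_or_ne k l with rfl | hkl
    · exact not_arcsCross_self _ _
    · rw [hl hk hkK.le, hl (by omega) hkK, hl hl1 hlK.le, hl (by omega) hlK]
      exact hcopies hk hkK hl1 hlK (by omega) hkl (by omega) (by omega) (by omega) (by omega)
  · rcases eq_or_ne k l with rfl | hkl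
    · exact (hparallel hk hkK).1
    · rw [hl hk hkK.le, hl (by omega) hkK, hr', hr', arcsCross_comm_right]
      exact hcopies hk hkK hl1 hlK (by omega) hkl (by omega) (by omega) (by omega) (by omega)
  · rw [hr', hr']
    exact (not_arcsCross_of_sameSide (hside' hk hkK hkx (by omega) (by omega))
      (hside' hk hkK hkx (by omega) (by omega))).1
  · rcases eq_or_ne k l with rfl | hkl
    · exact (hparallel hk hkK).2
    · rw [hl hl1 hlK.le, hl (by omega) hlK, hr', hr', arcsCross_comm_left]
      exact hcopies hk hkK hl1 hlK (by omega) hkl (by omega) (by omega) (by omega) (by omega)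
  · rcases eq_or_ne k l with rfl | hkl
    · exact not_arcsCross_self _ _
    · rw [hr', hr', hr', hr', arcsCross_comm_left, arcsCross_comm_right]
      exact hcopies hk hkK hl1 hlK (by omega) hkl (by omega) (by omega) (by omega) (by omega)

theorem cable_isOpenMeandricPerm (hc : IsSeed K c p i j) (ha : IsOpenMeandricPerm n a)
    (hn : n % 2 = 1) : IsOpenMeandricPerm (2 * n + K - 2) (cable n p i j c a) := by
  have h1 := hc.one_lt
  have h2 := hc.lt
  have h3 := hc.lt_order
  have hp := hc.le_order
  have hp2 := hc.odd_left
  obtain ⟨hi2, hj2⟩ := hc.index_mod_two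
  have hn1 := ha.1
  have hrange : ∀ r, 1 ≤ r → r ≤ n → 1 ≤ a r ∧ a r ≤ n := ha.2.1
  have hcrange : ∀ k, 1 ≤ k → k ≤ K → 1 ≤ c k ∧ c k ≤ K := hc.meandric.2.1
  have hq : ∀ s, 1 ≤ s → s ≤ n → 2 * a s - 2 + 2 ≤ 2 * n := by
    intro s hs hsn
    have := hrange s hs hsn
    omega
  have hends : ∀ {k x l : ℕ}, 1 ≤ k → k ≤ K → k ≠ i → k ≠ j → 1 ≤ x → x + 2 < K + 2 * n →
      cable n p i j c a l = stretch n p 0 (c k) →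
      (∀ y, 1 ≤ y → y < K → y % 2 = x % 2 → ¬ StrictlyBetween (c y) (c (y + 1)) (c k)) →
      ¬ StrictlyBetween (cable n p i j c a x) (cable n p i j c a (x + 1))
        (cable n p i j c a l) := by
    intro k x l hk hkK hki hkj hx hxN hl hex
    have hkp := hc.lt_or_gt hk hkK hki hkj
    have hcopy : ∀ {r s : ℕ}, 1 ≤ r → r ≤ n → 1 ≤ s → s ≤ n →
        ¬ StrictlyBetween (leftStrand p a r) (leftStrand p a s) (stretch n p 0 (c k)) ∧
          ¬ StrictlyBetween (rightStrand p a r) (rightStrand p a s) (stretch n p 0 (c k)) := by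
      intro r s hr hrn hs hsn
      have := hrange r hr hrn
      have := hrange s hs hsn
      unfold StrictlyBetween leftStrand rightStrand stretch
      split_ifs <;> omega
    rw [hl]
    rcases hc.cable_arc_cases ha hn hx hxN with
      ⟨y, hy, hyK, hyx, e1, e2⟩ | ⟨r, hr, hrn, hrx, e1, e2⟩ | ⟨r, hr, hrn, hrx, e1, e2⟩ <;>
      rw [e1, e2]
    · rw [hc.stretch_eq hk hkK hki hkj (2 * a (if x % 2 = 0 then 1 else n) - 2),
        strictlyBetween_stretch (hq _ (by split_ifs <;> omega) (by split_ifs <;> omega))]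
      exact hex y hy hyK hyx
    · exact (hcopy hr (by omega) (by omega) (by omega)).1
    · exact (hcopy (by omega) (by omega) (by omega) (by omega)).2
  have hfirst : cable n p i j c a 1 = stretch n p 0 (c 1) := cable_of_lt h1
  have hlast : cable n p i j c a (2 * n + K - 2) = stretch n p 0 (c K) :=
    cable_of_gt h2 h3 (by omega)
  apply isOpenMeandricPerm_of_bounded
  · omega
  · intro x hx hx1
    rcases hc.cable_cases (n := n) (a := a) hx1 (by omega) with
      ⟨k, hk, hkK, hkx, hkv⟩ | ⟨k, hk, hkK, hkx, hkv⟩ | ⟨k, hk, hkK, hkx, hkv⟩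
    · have := hcrange k hk hkK
      omega
    · have := hrange k hk hkK
      rw [hkv, leftStrand]
      omega
    · have := hrange k hk hkK
      rw [hkv, rightStrand]
      omega
  · intro x hx y hy hx1 hy1 h
    exact hc.cable_inj ha hx1 (by omega) hy1 (by omega) h
  · intro x hx hx1
    rcases hc.cable_cases (n := n) (a := a) hx1 (by omega) with
      ⟨k, hk, hkK, hkx, hkv⟩ | ⟨k, hk, hkK, hkx, hkv⟩ | ⟨k, hk, hkK, hkx, hkv⟩
    · have := hc.meandric.2.2.2.1 k hk hkK
      omega
    · have := hrange k hk hkK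
      rw [hkv, leftStrand]
      omega
    · have := hrange k hk hkK
      rw [hkv, rightStrand]
      omega
  · intro x hx y hy hx1 hy1 hxy
    exact hc.cable_not_arcsCross ha hn hx1 (by omega) hy1 (by omega) hxy
  · intro x hx hx1 hx2
    exact hends (k := 1) le_rfl (by omega) (by omega) (by omega) hx1 (by omega) hfirst
      fun y hy hyK hyx => hc.meandric.first_exposed hy hyK (by omega)
  · intro x hx hx1 hx2
    exact hends (k := K) (by omega) le_rfl (by omega) (by omega) hx1 (by omega) hlast
      fun y hy hyK hyx => hc.meandric.last_exposed hy hyK (by omega)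

theorem cable_eq_zero (hc : IsSeed K c p i j) (hn : 1 ≤ n) {x : ℕ}
    (hx : x < 1 ∨ 2 * n + K - 2 < x) : cable n p i j c a x = 0 := by
  have h1 := hc.one_lt
  have h2 := hc.lt
  have h3 := hc.lt_order
  have hp := hc.le_order
  rcases hx with hx | hx
  · rw [cable_of_lt (by omega), hc.eq_zero x (.inl hx), stretch, if_pos (by omega)]
  · rw [cable_of_gt (k := x + 2 - 2 * n) h2 (by omega) (by omega),
      hc.eq_zero _ (.inr (by omega)), stretch, if_pos (by omega)]

theorem cable_left_injective (hc : IsSeed K c p i j) {a' : ℕ → ℕ} (ha : IsOpenMeandricPerm n a)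
    (ha' : IsOpenMeandricPerm n a') (h : cable n p i j c a = cable n p i j c a') {r : ℕ}
    (hr : 1 ≤ r) (hrn : r ≤ n) : a r = a' r := by
  have h1 := congrFun h (i - 1 + r)
  have h2 := hc.one_lt
  have hp := hc.le_order
  have := ha.2.1 r hr hrn
  have := ha'.2.1 r hr hrn
  rw [cable_left hr hrn (by omega), cable_left hr hrn (by omega), leftStrand, leftStrand] at h1
  omega

theorem _root_.IsIrreducibleMeander.of_gaps {N : ℕ} {b : ℕ → ℕ}
    (hinj : ∀ x y, 1 ≤ x → x ≤ N → 1 ≤ y → y ≤ N → b x = b y → x = y)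
    (h : ∀ k₁ k₂, 1 ≤ k₁ → k₂ ≤ N → k₁ + 2 < k₂ → k₂ + 2 ≤ k₁ + N →
      ¬ ∀ x y v, k₁ ≤ x → x ≤ k₂ → k₁ ≤ y → y ≤ k₂ → b x ≤ v → v ≤ b y →
        ∃ z, k₁ ≤ z ∧ z ≤ k₂ ∧ b z = v) : IsIrreducibleMeander N b := by
  rintro ⟨k₁, k₂, hlt, h1, h2, h3, h4, h5⟩
  refine h k₁ k₂ h1 h2 (by omega) (by omega) fun x y v hx hx2 hy hy2 hxv hvy => ?_
  set W := Finset.Icc k₁ k₂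
  have hne : W.Nonempty := Finset.nonempty_Icc.mpr hlt.le
  have h5 : W.sup' hne b - W.inf' hne b = k₂ - k₁ := h5
  have hsub : W.image b ⊆ Finset.Icc (W.inf' hne b) (W.sup' hne b) := by
    intro u hu
    obtain ⟨z, hz, rfl⟩ := Finset.mem_image.mp hu
    exact Finset.mem_Icc.mpr ⟨Finset.inf'_le b hz, Finset.le_sup' b hz⟩
  have hcard : (W.image b).card = k₂ + 1 - k₁ := by
    rw [Finset.card_image_of_injOn, Nat.card_Icc]
    intro s hs t ht hst
    have hs := Finset.mem_Icc.mp hs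
    have ht := Finset.mem_Icc.mp ht
    exact hinj s t (by omega) (by omega) (by omega) (by omega) hst
  have heq := Finset.eq_of_subset_of_card_le hsub (by rw [hcard, Nat.card_Icc]; omega)
  have hx' := hsub (Finset.mem_image_of_mem b (Finset.mem_Icc.mpr ⟨hx, hx2⟩))
  have hy' := hsub (Finset.mem_image_of_mem b (Finset.mem_Icc.mpr ⟨hy, hy2⟩))
  rw [Finset.mem_Icc] at hx' hy'
  have hv : v ∈ W.image b := heq ▸ Finset.mem_Icc.mpr ⟨by omega, by omega⟩
  obtain ⟨z, hz, hzv⟩ := Finset.mem_image.mp hv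
  exact ⟨z, (Finset.mem_Icc.mp hz).1, (Finset.mem_Icc.mp hz).2, hzv⟩

theorem exists_gap (hc : IsSeed K c p i j) {m₁ m₂ : ℕ} (h1 : 1 ≤ m₁) (h2 : m₁ + 2 < m₂)
    (h3 : m₂ ≤ K) (h4 : m₂ + 2 ≤ m₁ + K) :
    ∃ x y v, (m₁ ≤ x ∧ x ≤ m₂) ∧ (m₁ ≤ y ∧ y ≤ m₂) ∧ c x ≤ v ∧ v ≤ c y ∧
      ∀ k, m₁ ≤ k → k ≤ m₂ → c k ≠ v := by
  obtain ⟨x, y, hx, hy, hxy⟩ := hc.spread m₁ m₂ h1 h2 h3 h4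
  by_contra! hcon
  have hsub : Finset.Icc (c x) (c y) ⊆ (Finset.Icc m₁ m₂).image c := by
    intro v hv
    rw [Finset.mem_Icc] at hv
    obtain ⟨k, hk1, hk2, hk⟩ := hcon x y v hx hy hv.1 hv.2
    exact Finset.mem_image.mpr ⟨k, Finset.mem_Icc.mpr ⟨hk1, hk2⟩, hk⟩
  have := (Finset.card_le_card hsub).trans Finset.card_image_le
  rw [Nat.card_Icc, Nat.card_Icc] at this
  omega

theorem cable_mem_block_iff (hc : IsSeed K c p i j) (ha : IsOpenMeandricPerm n a) {x : ℕ}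
    (hx : 1 ≤ x) (hxN : x + 2 ≤ K + 2 * n) :
    p ≤ cable n p i j c a x ∧ cable n p i j c a x + 1 ≤ p + 2 * n ↔
      i ≤ x ∧ x < i + n ∨ j + n ≤ x + 1 ∧ x + 1 < j + 2 * n := by
  have hn := ha.1
  have hij := hc.lt
  have hp := hc.le_order
  rcases hc.cable_cases (n := n) (a := a) hx hxN with
    ⟨k, hk, hkK, hkx, hkv⟩ | ⟨k, hk, hkK, hkx, hkv⟩ | ⟨k, hk, hkK, hkx, hkv⟩
  · omega
  · have := ha.2.1 k hk hkK
    rw [hkv, leftStrand]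
    omega
  · have := ha.2.1 k hk hkK
    rw [hkv, rightStrand]
    omega

/-- The two copies of the curve in a cabled curve cross the line in adjacent positions. -/
theorem exists_cable_adjacent (hc : IsSeed K c p i j) (ha : IsOpenMeandricPerm n a)
    (hn : n % 2 = 1) {x : ℕ} (hx : i ≤ x ∧ x < i + n ∨ j + n ≤ x + 1 ∧ x + 1 < j + 2 * n) :
    ∃ y, (x < i + n ∧ j + n ≤ y + 1 ∧ y + 1 < j + 2 * n ∨ j + n ≤ x + 1 ∧ i ≤ y ∧ y < i + n) ∧
      (x % 2 = 1 ∧ cable n p i j c a y = cable n p i j c a x + 1 ∨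
        x % 2 = 0 ∧ cable n p i j c a y + 1 = cable n p i j c a x) := by
  have hij := hc.lt
  have hp := hc.le_order
  obtain ⟨hi2, hj2⟩ := hc.index_mod_two
  rcases hx with hx | hx
  · have := ha.2.1 (x + 1 - i) (by omega) (by omega)
    refine ⟨j + 2 * n - 1 - (x + 1 - i), by omega, ?_⟩
    rw [cable_left (x := x) (r := x + 1 - i) (by omega) (by omega) (by omega),
      cable_right hij (r := x + 1 - i) (by omega) (by omega) (by omega), leftStrand, rightStrand]
    omega
  · have := ha.2.1 (j + 2 * n - 1 - x) (by omega) (by omega)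
    refine ⟨i + (j + 2 * n - 1 - x) - 1, by omega, ?_⟩
    rw [cable_left (r := j + 2 * n - 1 - x) (by omega) (by omega) (by omega),
      cable_right hij (x := x) (r := j + 2 * n - 1 - x) (by omega) (by omega) (by omega),
      leftStrand, rightStrand]
    omega

/-- An interval of indices in which the cabled curve looks like a part of the seed. -/
theorem not_convex_of_window (hc : IsSeed K c p i j) (ha : IsOpenMeandricPerm n a)
    {k₁ k₂ m₁ m₂ q : ℕ} (hq : q + 2 ≤ 2 * n) (hk₁ : 1 ≤ k₁) (hk₂ : k₂ + 2 ≤ K + 2 * n)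
    (h1 : 1 ≤ m₁) (h2 : m₁ + 2 < m₂) (h3 : m₂ ≤ K) (h4 : m₂ + 2 ≤ m₁ + K)
    (hpos : ∀ k x, k < i ∧ x = k ∨ i < k ∧ k < j ∧ x + 1 = k + n ∨ j < k ∧ x + 2 = k + 2 * n →
      (m₁ ≤ k ∧ k ≤ m₂ ↔ k₁ ≤ x ∧ x ≤ k₂))
    (hi : m₁ ≤ i → i ≤ m₂ → ∃ z, k₁ ≤ z ∧ z ≤ k₂ ∧ cable n p i j c a z = p + q)
    (hj : m₁ ≤ j → j ≤ m₂ → ∃ z, k₁ ≤ z ∧ z ≤ k₂ ∧ cable n p i j c a z = p + 1 + q)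
    (hblock : ∀ z, k₁ ≤ z → z ≤ k₂ → i ≤ z ∧ z < i + n ∨ j + n ≤ z + 1 ∧ z + 1 < j + 2 * n →
      (m₁ ≤ i ∧ i ≤ m₂) ∧ (m₁ ≤ j ∧ j ≤ m₂) ∨
        (m₁ ≤ i ∧ i ≤ m₂) ∧ cable n p i j c a z = p + q ∨
        (m₁ ≤ j ∧ j ≤ m₂) ∧ cable n p i j c a z = p + 1 + q) :
    ¬ ∀ x y v, k₁ ≤ x → x ≤ k₂ → k₁ ≤ y → y ≤ k₂ → cable n p i j c a x ≤ v →
      v ≤ cable n p i j c a y → ∃ z, k₁ ≤ z ∧ z ≤ k₂ ∧ cable n p i j c a z = v := by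
  intro hconv
  have hij := hc.lt
  have ei := hc.eq_left
  have ej := hc.eq_right
  have hlift : ∀ k, m₁ ≤ k → k ≤ m₂ →
      ∃ z, k₁ ≤ z ∧ z ≤ k₂ ∧ cable n p i j c a z = stretch n p q (c k) := by
    intro k hk hkm
    by_cases hki : k = i
    · obtain ⟨z, hz, hz2, e⟩ := hi (by omega) (by omega)
      refine ⟨z, hz, hz2, ?_⟩
      rw [e, hki, ei, stretch, if_neg (by omega), if_pos (by omega)]
    by_cases hkj : k = j
    · obtain ⟨z, hz, hz2, e⟩ := hj (by omega) (by omega)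
      refine ⟨z, hz, hz2, ?_⟩
      rw [e, hkj, ej, stretch, if_neg (by omega), if_pos (by omega)]
    rw [← hc.stretch_eq (by omega) (by omega) hki hkj]
    rcases (by omega : k < i ∨ i < k ∧ k < j ∨ j < k) with h | h | h
    · have := (hpos k k (by omega)).mp ⟨hk, hkm⟩
      exact ⟨k, this.1, this.2, cable_of_lt h⟩
    · have := (hpos k (k + n - 1) (by omega)).mp ⟨hk, hkm⟩
      exact ⟨k + n - 1, this.1, this.2, cable_between h.1 h.2 (by omega)⟩
    · have := (hpos k (k + 2 * n - 2) (by omega)).mp ⟨hk, hkm⟩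
      exact ⟨k + 2 * n - 2, this.1, this.2, cable_of_gt hij h (by omega)⟩
  obtain ⟨x, y, v, hx, hy, hxv, hvy, hv⟩ := hc.exists_gap h1 h2 h3 h4
  obtain ⟨x', hx1, hx2, hx'⟩ := hlift x hx.1 hx.2
  obtain ⟨y', hy1, hy2, hy'⟩ := hlift y hy.1 hy.2
  obtain ⟨z, hz1, hz2, hz⟩ := hconv x' y' (stretch n p q v) hx1 hx2 hy1 hy2
    (by rw [hx', ← not_lt, stretch_lt_stretch hq]; omega)
    (by rw [hy', ← not_lt, stretch_lt_stretch hq]; omega)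
  have hmem := hc.cable_mem_block_iff ha (x := z) (by omega) (by omega)
  by_cases hzb : i ≤ z ∧ z < i + n ∨ j + n ≤ z + 1 ∧ z + 1 < j + 2 * n
  · have hzm := hmem.mpr hzb
    have hvi : (m₁ ≤ i ∧ i ≤ m₂) → v ≠ p := fun h e => hv i h.1 h.2 (by omega)
    have hvj : (m₁ ≤ j ∧ j ≤ m₂) → v ≠ p + 1 := fun h e => hv j h.1 h.2 (by omega)
    have hb := hblock z hz1 hz2 hzb
    unfold stretch at hz
    split_ifs at hz <;> omega
  · rcases hc.cable_cases (n := n) (a := a) (x := z) (by omega) (by omega) with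
      ⟨k, hk, hkK, hkx, hkv⟩ | ⟨k, hk, hkK, hkx, -⟩ | ⟨k, hk, hkK, hkx, -⟩
    · have hkm := (hpos k z hkx).mpr ⟨hz1, hz2⟩
      apply hv k hkm.1 hkm.2
      unfold stretch at hz
      split_ifs at hz <;> omega
    · omega
    · omega

set_option maxHeartbeats 1000000 in
theorem cable_isIrreducible (hc : IsSeed K c p i j) (ha : IsOpenMeandricPerm n a)
    (hn : n % 2 = 1) : IsIrreducibleMeander (2 * n + K - 2) (cable n p i j c a) := by
  have hij := hc.lt
  have hi1 := hc.one_lt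
  have hjK := hc.lt_order
  have hp := hc.le_order
  have hp2 := hc.odd_left
  obtain ⟨hi2, hj2⟩ := hc.index_mod_two
  have hb := hc.cable_isOpenMeandricPerm ha hn
  apply IsIrreducibleMeander.of_gaps hb.2.2.1
  intro k₁ k₂ hk₁ hk₂ hlen hlen2 hconv
  have hinj : ∀ {x y}, k₁ ≤ x → x ≤ k₂ → 1 ≤ y → y + 2 ≤ K + 2 * n →
      cable n p i j c a x = cable n p i j c a y → x = y := by
    intro x y h1 h2 h3 h4 h
    exact hc.cable_inj ha (by omega) (by omega) h3 h4 h
  have hmem : ∀ {x}, k₁ ≤ x → x ≤ k₂ → _ := fun {x} h1 h2 =>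
    hc.cable_mem_block_iff ha (x := x) (by omega) (by omega)
  have hpar : ∀ {x}, k₁ ≤ x → x ≤ k₂ → cable n p i j c a x % 2 = x % 2 := by
    intro x h1 h2
    exact hb.2.2.2.1 x (by omega) (by omega)
  obtain ⟨s, his, hsj, hs⟩ := hc.exists_below
  obtain ⟨t, hit, htj, ht⟩ := hc.exists_above
  have hst : s ≠ t := by rintro rfl; omega
  have ha1 := ha.2.1 1 le_rfl ha.1
  have e1 : cable n p i j c a i = p + (2 * a 1 - 2) := by
    rw [cable_left (r := 1) le_rfl ha.1 rfl, leftStrand]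
    omega
  have e2 : cable n p i j c a (j + 2 * n - 2) = p + 1 + (2 * a 1 - 2) := by
    rw [cable_right hij (r := 1) le_rfl ha.1 (by omega), rightStrand]
    omega
  -- the interval does not meet both copies
  have hone : ¬ (k₁ < i + n ∧ j + n ≤ k₂ + 1) ∨ k₂ < i ∨ j + 2 * n ≤ k₁ + 1 := by
    by_contra! hcon
    have es : cable n p i j c a (s + n - 1) < p := by
      rw [cable_between his hsj (by omega), stretch, if_pos hs]
      exact hs
    have et : p + 2 * n - 1 < cable n p i j c a (t + n - 1) := by
      rw [cable_between hit htj (by omega), stretch, if_neg (by omega), if_neg (by omega)]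
      omega
    have hfull : ∀ v, p ≤ v → v + 1 ≤ p + 2 * n →
        ∃ z, k₁ ≤ z ∧ z ≤ k₂ ∧ cable n p i j c a z = v := fun v h1 h2 =>
      hconv (s + n - 1) (t + n - 1) v (by omega) (by omega) (by omega) (by omega)
        (by omega) (by omega)
    have hi' : k₁ ≤ i ∧ i ≤ k₂ := by
      obtain ⟨z, hz1, hz2, hz⟩ := hfull (p + (2 * a 1 - 2)) (by omega) (by omega)
      have := hinj (y := i) hz1 hz2 (by omega) (by omega) (hz.trans e1.symm)
      omega
    have hj' : k₁ ≤ j + 2 * n - 2 ∧ j + 2 * n - 2 ≤ k₂ := by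
      obtain ⟨z, hz1, hz2, hz⟩ := hfull (p + 1 + (2 * a 1 - 2)) (by omega) (by omega)
      have := hinj (y := j + 2 * n - 2) hz1 hz2 (by omega) (by omega) (hz.trans e2.symm)
      omega
    exact hc.not_convex_of_window ha (k₁ := k₁) (k₂ := k₂) (m₁ := k₁) (m₂ := k₂ + 2 - 2 * n)
      (q := 2 * a 1 - 2) (by omega) hk₁ (by omega) (by omega) (by omega) (by omega) (by omega)
      (by omega) (fun _ _ => ⟨i, hi'.1, hi'.2, e1⟩) (fun _ _ => ⟨_, hj'.1, hj'.2, e2⟩)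
      (by omega) hconv
  -- a crossing in a copy is extremal in the interval
  have hext : ∀ {x y}, k₁ ≤ x → x ≤ k₂ → k₁ ≤ y → y ≤ k₂ →
      i ≤ x ∧ x < i + n ∨ j + n ≤ x + 1 ∧ x + 1 < j + 2 * n →
      x % 2 = 1 ∧ cable n p i j c a y ≤ cable n p i j c a x ∨
        x % 2 = 0 ∧ cable n p i j c a x ≤ cable n p i j c a y := by
    intro x y hx1 hx2 hy1 hy2 hx
    obtain ⟨w, hw, hwv⟩ := hc.exists_cable_adjacent ha hn hx
    by_contra! hcon
    obtain ⟨z, hz1, hz2, hz⟩ : ∃ z, k₁ ≤ z ∧ z ≤ k₂ ∧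
        cable n p i j c a z = cable n p i j c a w := by
      rcases hwv with hwv | hwv
      · exact hconv x y _ hx1 hx2 hy1 hy2 (by omega) (by omega)
      · exact hconv y x _ hy1 hy2 hx1 hx2 (by omega) (by omega)
    have := hinj hz1 hz2 (by omega) (by omega) hz
    omega
  -- the interval contains at most one crossing in a copy
  have huniq : ∀ {x y}, k₁ ≤ x → x ≤ k₂ → k₁ ≤ y → y ≤ k₂ →
      i ≤ x ∧ x < i + n ∨ j + n ≤ x + 1 ∧ x + 1 < j + 2 * n →
      i ≤ y ∧ y < i + n ∨ j + n ≤ y + 1 ∧ y + 1 < j + 2 * n → ¬ x < y := by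
    intro x y hx1 hx2 hy1 hy2 hx hy hxy
    have hx' : i ≤ x + 1 ∧ x + 1 < i + n ∨ j + n ≤ x + 1 + 1 ∧ x + 1 + 1 < j + 2 * n := by
      omega
    have hall : ∀ {z}, k₁ ≤ z → z ≤ k₂ →
        i ≤ z ∧ z < i + n ∨ j + n ≤ z + 1 ∧ z + 1 < j + 2 * n := by
      intro z hz1 hz2
      have b1 := (hmem hx1 hx2).mpr hx
      have b2 := (hmem (x := x + 1) (by omega) (by omega)).mpr hx'
      have b3 := hext hx1 hx2 hz1 hz2 hx
      have b4 := hext (x := x + 1) (by omega) (by omega) hz1 hz2 hx'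
      exact (hmem hz1 hz2).mp (by omega)
    have b1 := hext (x := k₁) (y := k₁ + 2) (by omega) (by omega) (by omega) (by omega)
      (hall (by omega) (by omega))
    have b2 := hext (x := k₁ + 2) (y := k₁) (by omega) (by omega) (by omega) (by omega)
      (hall (by omega) (by omega))
    have := hinj (x := k₁) (y := k₁ + 2) (by omega) (by omega) (by omega) (by omega) (by omega)
    omega
  -- the remaining intervals look like a part of the seed
  by_cases hL : k₁ < i + n ∧ i ≤ k₂
  · have hlast : k₂ + 1 < j + n := by omega
    obtain ⟨m, hm1, hm2, hmi, hmn⟩ : ∃ m, k₁ ≤ m ∧ m ≤ k₂ ∧ i ≤ m ∧ m < i + n := by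
      rcases le_total k₁ i with h | h
      · exact ⟨i, h, hL.2, le_rfl, by omega⟩
      · exact ⟨k₁, le_rfl, by omega, h, hL.1⟩
    have hm : ∀ {z}, k₁ ≤ z → z ≤ k₂ →
        i ≤ z ∧ z < i + n ∨ j + n ≤ z + 1 ∧ z + 1 < j + 2 * n → z = m := by
      intro z hz1 hz2 hz
      have h1 := huniq hz1 hz2 hm1 hm2 hz (by omega)
      have h2 := huniq hm1 hm2 hz1 hz2 (by omega) hz
      omega
    have hmi' : k₁ < m → m = i := by
      intro h
      by_contra hne
      have := hm (z := m - 1) (by omega) (by omega) (by omega)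
      omega
    have hmn' : m < k₂ → m = i + n - 1 := by
      intro h
      by_contra hne
      have := hm (z := m + 1) (by omega) (by omega) (by omega)
      omega
    have hmb := (hmem hm1 hm2).mpr (by omega)
    have hmodd : m % 2 = 1 := by omega
    have hmv : cable n p i j c a m = p := by
      have hmpar := hpar hm1 hm2
      obtain ⟨z, hz1, hz2, hzm⟩ : ∃ z, k₁ ≤ z ∧ z ≤ k₂ ∧ z ≠ m := by
        rcases Nat.lt_or_ge k₁ m with h | h
        · exact ⟨k₁, le_rfl, by omega, by omega⟩
        · exact ⟨k₂, by omega, le_rfl, by omega⟩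
      have hz := hext hm1 hm2 hz1 hz2 (by omega)
      have hzb := mt (hmem hz1 hz2).mp fun h => hzm (hm hz1 hz2 h)
      obtain ⟨w, hw1, hw2, hw⟩ := hconv z m p hz1 hz2 hm1 hm2 (by omega) (by omega)
      rw [← hm hw1 hw2 ((hmem hw1 hw2).mp (by omega))]
      exact hw
    have hwin : ∀ k, ∃ m, k ≤ i ∧ m = k ∨ i < k ∧ m = k + 1 - n := fun k => by
      rcases Nat.lt_or_ge i k with h | h
      · exact ⟨k + 1 - n, .inr ⟨h, rfl⟩⟩
      · exact ⟨k, .inl ⟨h, rfl⟩⟩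
    obtain ⟨m₁, hm₁⟩ := hwin k₁
    obtain ⟨m₂, hm₂⟩ := hwin k₂
    exact hc.not_convex_of_window ha (k₁ := k₁) (k₂ := k₂) (q := 0) (m₁ := m₁) (m₂ := m₂)
      (by omega) hk₁ (by omega) (by omega) (by omega) (by omega) (by omega) (by omega)
      (fun _ _ => ⟨m, hm1, hm2, hmv⟩) (by omega)
      (fun z hz1 hz2 hz => .inr (.inl ⟨by omega, by rw [hm hz1 hz2 hz, hmv]; rfl⟩)) hconv
  by_cases hR : k₁ + 1 < j + 2 * n ∧ j + n ≤ k₂ + 1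
  · have hfirst : i + n ≤ k₁ := by omega
    obtain ⟨m, hm1, hm2, hmi, hmn⟩ : ∃ m, k₁ ≤ m ∧ m ≤ k₂ ∧ j + n ≤ m + 1 ∧
        m + 1 < j + 2 * n := by
      rcases le_total (k₁ + 1) (j + n) with h | h
      · exact ⟨j + n - 1, by omega, by omega, by omega, by omega⟩
      · exact ⟨k₁, le_rfl, by omega, h, hR.1⟩
    have hm : ∀ {z}, k₁ ≤ z → z ≤ k₂ →
        i ≤ z ∧ z < i + n ∨ j + n ≤ z + 1 ∧ z + 1 < j + 2 * n → z = m := by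
      intro z hz1 hz2 hz
      have h1 := huniq hz1 hz2 hm1 hm2 hz (by omega)
      have h2 := huniq hm1 hm2 hz1 hz2 (by omega) hz
      omega
    have hmi' : k₁ < m → m + 1 = j + n := by
      intro h
      by_contra hne
      have := hm (z := m - 1) (by omega) (by omega) (by omega)
      omega
    have hmn' : m < k₂ → m + 2 = j + 2 * n := by
      intro h
      by_contra hne
      have := hm (z := m + 1) (by omega) (by omega) (by omega)
      omega
    have hmb := (hmem hm1 hm2).mpr (by omega)
    have hmeven : m % 2 = 0 := by omega
    have hmv : cable n p i j c a m = p + 1 + (2 * n - 2) := by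
      have hmpar := hpar hm1 hm2
      obtain ⟨z, hz1, hz2, hzm⟩ : ∃ z, k₁ ≤ z ∧ z ≤ k₂ ∧ z ≠ m := by
        rcases Nat.lt_or_ge k₁ m with h | h
        · exact ⟨k₁, le_rfl, by omega, by omega⟩
        · exact ⟨k₂, by omega, le_rfl, by omega⟩
      have hz := hext hm1 hm2 hz1 hz2 (by omega)
      have hzb := mt (hmem hz1 hz2).mp fun h => hzm (hm hz1 hz2 h)
      obtain ⟨w, hw1, hw2, hw⟩ := hconv m z (p + 1 + (2 * n - 2)) hm1 hm2 hz1 hz2 (by omega)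
        (by omega)
      rw [← hm hw1 hw2 ((hmem hw1 hw2).mp (by omega))]
      exact hw
    have hwin : ∀ k, ∃ m, k < j + n ∧ m = k + 1 - n ∨ j + n ≤ k ∧ m = k + 2 - 2 * n :=
      fun k => by
        rcases Nat.lt_or_ge k (j + n) with h | h
        · exact ⟨k + 1 - n, .inl ⟨h, rfl⟩⟩
        · exact ⟨k + 2 - 2 * n, .inr ⟨h, rfl⟩⟩
    obtain ⟨m₁, hm₁⟩ := hwin k₁
    obtain ⟨m₂, hm₂⟩ := hwin k₂
    exact hc.not_convex_of_window ha (k₁ := k₁) (k₂ := k₂) (q := 2 * n - 2) (m₁ := m₁)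
      (m₂ := m₂)
      (by omega) hk₁ (by omega) (by omega) (by omega) (by omega) (by omega) (by omega)
      (by omega) (fun _ _ => ⟨m, hm1, hm2, hmv⟩)
      (fun z hz1 hz2 hz => .inr (.inr ⟨by omega, by rw [hm hz1 hz2 hz, hmv]⟩)) hconv
  rcases (by omega : k₂ < i ∨ i + n ≤ k₁ ∧ k₂ + 1 < j + n ∨ j + 2 * n ≤ k₁ + 1)
    with h | h | h
  · exact hc.not_convex_of_window ha (k₁ := k₁) (k₂ := k₂) (q := 0) (m₁ := k₁) (m₂ := k₂)
      (by omega) hk₁ (by omega) (by omega) (by omega) (by omega) (by omega) (by omega)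
      (by omega) (by omega) (by omega) hconv
  · exact hc.not_convex_of_window ha (k₁ := k₁) (k₂ := k₂) (q := 0) (m₁ := k₁ + 1 - n)
      (m₂ := k₂ + 1 - n)
      (by omega) hk₁ (by omega) (by omega) (by omega) (by omega) (by omega) (by omega)
      (by omega) (by omega) (by omega) hconv
  · exact hc.not_convex_of_window ha (k₁ := k₁) (k₂ := k₂) (q := 0) (m₁ := k₁ + 2 - 2 * n)
      (m₂ := k₂ + 2 - 2 * n)
      (by omega) hk₁ (by omega) (by omega) (by omega) (by omega) (by omega) (by omega)
      (by omega) (by omega) (by omega) hconv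

end IsSeed

end Cable

theorem finite_bounded_sequences (N : ℕ) :
    {a : ℕ → ℕ | (∀ i, 1 ≤ i → i ≤ N → 1 ≤ a i ∧ a i ≤ N) ∧
      ∀ i, i < 1 ∨ N < i → a i = 0}.Finite := by
  let f : ((i : Fin (N + 1)) → Fin (N + 1)) → ℕ → ℕ :=
    fun g i => if h : i < N + 1 then g ⟨i, h⟩ else 0
  refine (Set.finite_range f).subset fun a ha => ?_
  have hle : ∀ i, a i < N + 1 := by
    intro i
    by_cases h : i < 1 ∨ N < i
    · rw [ha.2 i h]
      omega
    · have := ha.1 i (by omega) (by omega)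
      omega
  refine ⟨fun i => ⟨a i, hle i⟩, funext fun i => ?_⟩
  by_cases h : i < N + 1
  · simp only [f, dif_pos h]
  · simp only [f, dif_neg h]
    exact (ha.2 i (by omega)).symm

theorem eq_of_eq_on_order {n : ℕ} {a a' : ℕ → ℕ} (ha : ∀ i, i < 1 ∨ n < i → a i = 0)
    (ha' : ∀ i, i < 1 ∨ n < i → a' i = 0) (h : ∀ r, 1 ≤ r → r ≤ n → a r = a' r) : a = a' := by
  funext r
  by_cases hr : r < 1 ∨ n < r
  · rw [ha r hr, ha' r hr]
  · exact h r (by omega) (by omega)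

theorem openMeanderCount_le_irrMeanderCount {K n p i j : ℕ} {c : ℕ → ℕ} (hc : IsSeed K c p i j)
    (hn : n % 2 = 1) : openMeanderCount n ≤ irrMeanderCount (2 * n + K - 2) := by
  refine Set.ncard_le_ncard_of_injOn (cable n p i j c) ?_ ?_
    ((finite_bounded_sequences (2 * n + K - 2)).subset fun b hb => ⟨hb.1.2.1, hb.2.2⟩)
  · rintro a ⟨ha, -⟩
    exact ⟨hc.cable_isOpenMeandricPerm ha hn, hc.cable_isIrreducible ha hn,
      fun x hx => hc.cable_eq_zero ha.1 hx⟩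
  · rintro a ⟨ha, ha0⟩ a' ⟨ha', ha0'⟩ h
    exact eq_of_eq_on_order ha0 ha0' fun r => hc.cable_left_injective ha ha' h

theorem sum_mod_two_eq_zero_of_pairs {f : ℕ → ℕ} {l k : ℕ} (hkl : k % 2 = l % 2) (hlk : l ≤ k)
    (h : ∀ x, l ≤ x → x < k → x % 2 = l % 2 → (f x + f (x + 1)) % 2 = 0) :
    (∑ x ∈ Finset.Ico l k, f x) % 2 = 0 := by
  obtain ⟨m, rfl⟩ : ∃ m, k = l + 2 * m := ⟨(k - l) / 2, by omega⟩
  clear hkl hlk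
  induction m with
  | zero => simp
  | succ m ih =>
    have h1 := ih fun x hx hxk => h x hx (by omega)
    have h2 := h (l + 2 * m) (by omega) (by omega) (by omega)
    rw [show l + 2 * (m + 1) = l + 2 * m + 1 + 1 by ring, Finset.sum_Ico_succ_top (by omega),
      Finset.sum_Ico_succ_top (by omega)]
    omega

/-- Indicates whether the `x`-th crossing of `a` lies to the left of `u`. -/
def leftOf (a : ℕ → ℕ) (u x : ℕ) : ℕ := if a x < u then 1 else 0

theorem leftOf_add_mod_two {a : ℕ → ℕ} {u x y : ℕ} (hx : a x ≠ u) (hy : a y ≠ u) :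
    (leftOf a u x + leftOf a u y) % 2 = 1 ↔ StrictlyBetween (a x) (a y) u := by
  simp only [StrictlyBetween, min_lt_iff, lt_max_iff]
  by_cases h1 : a x < u <;> by_cases h2 : a y < u <;> simp [leftOf, h1, h2] <;> omega

theorem exists_eq_one {n : ℕ} {a : ℕ → ℕ} (ha : IsOpenMeandricPerm n a) :
    ∃ k, 1 ≤ k ∧ k ≤ n ∧ a k = 1 := by
  have h := Finset.surj_on_of_inj_on_of_card_le (s := Finset.Icc 1 n) (t := Finset.Icc 1 n)
    (fun k _ => a k) (fun k hk => by
      rw [Finset.mem_Icc] at *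
      exact ha.2.1 k hk.1 hk.2) (fun k l hk hl h => by
      rw [Finset.mem_Icc] at *
      exact ha.2.2.1 k l hk.1 hk.2 hl.1 hl.2 h) le_rfl 1 (Finset.mem_Icc.mpr ⟨le_rfl, ha.1⟩)
  obtain ⟨k, hk, h⟩ := h
  rw [Finset.mem_Icc] at hk
  exact ⟨k, hk.1, hk.2, h.symm⟩

/-- An open meander of even order starts to the left of its end. -/
theorem first_lt_last {n : ℕ} {a : ℕ → ℕ} (ha : IsOpenMeandricPerm n a) (hn : n % 2 = 0) :
    a 1 < a n := by
  obtain ⟨k, hk, hkn, hak⟩ := exists_eq_one ha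
  have hk2 := ha.2.2.2.1 k hk hkn
  have hne : ∀ {x y}, 1 ≤ x → x ≤ n → 1 ≤ y → y ≤ n → x ≠ y → a x ≠ a y :=
    fun hx hxn hy hyn hxy h => hxy (ha.2.2.1 _ _ hx hxn hy hyn h)
  have hgt : ∀ {x}, 1 ≤ x → x ≤ n → x ≠ k → 1 < a x := by
    intro x hx hxn hxk
    have := hne hx hxn hk hkn hxk
    have := ha.2.1 x hx hxn
    omega
  have hkey : ∀ x, k + 1 ≤ x → x ≤ n → (∑ l ∈ Finset.Ico 1 (k + 1), leftOf a (a x) l) % 2 = 1 := by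
    intro x hx
    induction x, hx using Nat.le_induction with
    | base =>
      intro hkn'
      have h1 : (∑ l ∈ Finset.Ico 1 k, leftOf a (a (k + 1)) l) % 2 = 0 := by
        apply sum_mod_two_eq_zero_of_pairs (by omega) hk
        intro l hl hlk hl2
        have h2 := not_arcsCross_iff.mp
          (ha.not_arcsCross hl (by omega) hk (by omega) (by omega : l % 2 = k % 2))
        have h3 : ¬ StrictlyBetween (a l) (a (l + 1)) (a k) := by
          have := hgt hl (by omega) (by omega)
          have := ha.2.1 (l + 1) (by omega) (by omega)
          simp only [StrictlyBetween, min_lt_iff, lt_max_iff]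
          omega
        have h4 := leftOf_add_mod_two (hne hl (by omega) (y := k + 1) (by omega) hkn' (by omega))
          (hne (x := l + 1) (by omega) (by omega) (y := k + 1) (by omega) hkn' (by omega))
        have := mt h4.mp (mt h2.mpr h3)
        omega
      rw [Finset.sum_Ico_succ_top hk, leftOf.eq_1 a _ k,
        if_pos (hak ▸ hgt (by omega) hkn' (by omega))]
      omega
    | succ x hx ih =>
      intro hxn
      have h1 := ih (by omega)
      have hpair : ∀ l, 1 ≤ l → l < k → l % 2 = x % 2 →
          (leftOf a (a x) l + leftOf a (a (x + 1)) l +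
            (leftOf a (a x) (l + 1) + leftOf a (a (x + 1)) (l + 1))) % 2 = 0 := by
        intro l hl hlk hlx
        have h2 := not_arcsCross_iff.mp
          (ha.not_arcsCross hl (by omega) (by omega) (by omega) hlx)
        rw [← leftOf_add_mod_two (hne hl (by omega) (by omega) (by omega) (by omega))
            (hne (by omega) (by omega) (by omega) (by omega) (by omega)),
          ← leftOf_add_mod_two (hne hl (by omega) (by omega) (by omega) (by omega))
            (hne (by omega) (by omega) (by omega) (by omega) (by omega))] at h2
        omega
      suffices h : (∑ l ∈ Finset.Ico 1 (k + 1),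
          (leftOf a (a x) l + leftOf a (a (x + 1)) l)) % 2 = 0 by
        rw [Finset.sum_add_distrib] at h
        omega
      rcases Nat.mod_two_eq_zero_or_one x with hx2 | hx2
      · have h2 : (∑ l ∈ Finset.Ico 2 (k + 1),
            (leftOf a (a x) l + leftOf a (a (x + 1)) l)) % 2 = 0 :=
          sum_mod_two_eq_zero_of_pairs (by omega) (by omega) fun l hl hlk hl2 =>
            hpair l (by omega) (by omega) (by omega)
        have h3 := ha.first_exposed (by omega) (by omega : x < n) hx2
        have h4 := hne (x := 1) le_rfl (by omega) (y := x) (by omega) (by omega) (by omega)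
        have h5 := hne (x := 1) le_rfl (by omega) (y := x + 1) (by omega) (by omega) (by omega)
        rw [Finset.sum_eq_sum_Ico_succ_bot (by omega)]
        suffices h : (leftOf a (a x) 1 + leftOf a (a (x + 1)) 1) % 2 = 0 by
          rw [one_add_one_eq_two]
          omega
        simp only [StrictlyBetween, min_lt_iff, lt_max_iff] at h3
        unfold leftOf
        split_ifs <;> omega
      · have h2 : (∑ l ∈ Finset.Ico 1 k,
            (leftOf a (a x) l + leftOf a (a (x + 1)) l)) % 2 = 0 :=
          sum_mod_two_eq_zero_of_pairs (by omega) (by omega) fun l hl hlk hl2 =>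
            hpair l (by omega) (by omega) (by omega)
        have h4 := hgt (x := x) (by omega) (by omega) (by omega)
        have h5 := hgt (x := x + 1) (by omega) (by omega) (by omega)
        rw [Finset.sum_Ico_succ_top hk, leftOf, leftOf, if_pos (hak ▸ h4), if_pos (hak ▸ h5)]
        omega
  have h1 := hkey n (by omega) le_rfl
  have h2 : (∑ l ∈ Finset.Ico 2 (k + 1), leftOf a (a n) l) % 2 = 0 := by
    apply sum_mod_two_eq_zero_of_pairs (by omega) (by omega)
    intro l hl hlk hl2
    have h3 := ha.last_exposed (by omega) (by omega : l < n) (by omega)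
    rw [← leftOf_add_mod_two (hne (by omega) (by omega) (by omega) le_rfl (by omega))
      (hne (by omega) (by omega) (by omega) le_rfl (by omega))] at h3
    omega
  rw [Finset.sum_eq_sum_Ico_succ_bot (by omega), one_add_one_eq_two, leftOf.eq_1 a _ 1] at h1
  by_contra h
  rw [if_neg h] at h1
  omega

theorem update_isOpenMeandricPerm {n : ℕ} {a : ℕ → ℕ} (ha : IsOpenMeandricPerm n a)
    (hn : n % 2 = 0) : IsOpenMeandricPerm (n + 1) (Function.update a (n + 1) (n + 1)) := by
  have h1 := ha.1
  have hlt := first_lt_last ha hn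
  have hold : ∀ {x}, x ≤ n → Function.update a (n + 1) (n + 1) x = a x := fun hx =>
    Function.update_of_ne (by omega) _ _
  have hnew : Function.update a (n + 1) (n + 1) (n + 1) = n + 1 := Function.update_self _ _ _
  apply isOpenMeandricPerm_of_bounded
  · omega
  · intro x hx hx1
    rcases (by omega : x ≤ n ∨ x = n + 1) with h | rfl
    · have := ha.2.1 x hx1 h
      rw [hold h]
      omega
    · rw [hnew]
      omega
  · intro x hx y hy hx1 hy1 h
    rcases (by omega : x ≤ n ∨ x = n + 1) with hx' | rfl <;>
      rcases (by omega : y ≤ n ∨ y = n + 1) with hy' | rfl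
    · rw [hold hx', hold hy'] at h
      exact ha.2.2.1 x y hx1 hx' hy1 hy' h
    · have := ha.2.1 x hx1 hx'
      rw [hold hx', hnew] at h
      omega
    · have := ha.2.1 y hy1 hy'
      rw [hold hy', hnew] at h
      omega
    · rfl
  · intro x hx hx1
    rcases (by omega : x ≤ n ∨ x = n + 1) with h | rfl
    · rw [hold h]
      exact ha.2.2.2.1 x hx1 h
    · rw [hnew]
  · intro x hx y hy hx1 hy1 hxy
    have hcomm : ∀ {z}, 1 ≤ z → z < n → z % 2 = 0 →
        ¬ ArcsCross (a z) (a (z + 1)) (a n) (n + 1) ∧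
          ¬ ArcsCross (a n) (n + 1) (a z) (a (z + 1)) := by
      intro z hz hzn hz2
      have h2 := ha.last_exposed hz hzn (by omega)
      have h3 := ha.2.1 z hz hzn.le
      have h4 := ha.2.1 (z + 1) (by omega) hzn
      have h5 := mt (ha.2.2.1 z n hz hzn.le h1 le_rfl) hzn.ne
      by_cases h6 : z + 1 = n
      · rw [h6] at h4 ⊢
        rw [not_arcsCross_iff, not_arcsCross_iff]
        simp only [StrictlyBetween, min_lt_iff, lt_max_iff]
        omega
      · have h7 := mt (ha.2.2.1 (z + 1) n (by omega) hzn h1 le_rfl) h6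
        rw [not_arcsCross_iff, not_arcsCross_iff]
        simp only [StrictlyBetween, min_lt_iff, lt_max_iff] at *
        omega
    rcases (by omega : x < n ∨ n = x) with hx' | rfl <;>
      rcases (by omega : y < n ∨ n = y) with hy' | rfl
    · rw [hold hx'.le, hold hx', hold hy'.le, hold hy']
      exact ha.not_arcsCross hx1 hx' hy1 hy' hxy
    · rw [hold hx'.le, hold hx', hold le_rfl, hnew]
      exact (hcomm hx1 hx' (by omega)).1
    · rw [hold hy'.le, hold hy', hold le_rfl, hnew]
      exact (hcomm hy1 hy' (by omega)).2
    · exact not_arcsCross_self _ _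
  · intro x hx hx1 hx2
    rcases (by omega : x < n ∨ n = x) with hx' | rfl
    · rw [hold hx'.le, hold hx', hold h1]
      exact ha.first_exposed hx1 hx' hx2
    · have := ha.2.1 1 le_rfl h1
      rw [hold le_rfl, hnew, hold h1]
      simp only [StrictlyBetween, min_lt_iff, lt_max_iff]
      omega
  · intro x hx hx1 hx2
    have h2 := ha.2.1 x hx1 (by omega)
    have h3 := ha.2.1 (x + 1) (by omega) (by omega)
    rw [hold (by omega), hold (by omega), hnew]
    simp only [StrictlyBetween, min_lt_iff, lt_max_iff]
    omega

theorem openMeanderCount_le_succ {n : ℕ} (hn : n % 2 = 0) :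
    openMeanderCount n ≤ openMeanderCount (n + 1) := by
  refine Set.ncard_le_ncard_of_injOn (fun a => Function.update a (n + 1) (n + 1)) ?_ ?_
    ((finite_bounded_sequences (n + 1)).subset fun b hb => ⟨hb.1.2.1, hb.2⟩)
  · rintro a ⟨ha, ha0⟩
    refine ⟨update_isOpenMeandricPerm ha hn, fun x hx => ?_⟩
    rw [Function.update_of_ne (by omega)]
    exact ha0 x (by omega)
  · rintro a ⟨-, ha0⟩ a' ⟨-, ha0'⟩ h
    refine eq_of_eq_on_order ha0 ha0' fun r hr hrn => ?_
    have hr' := congrFun h r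
    simp only at hr'
    rwa [Function.update_of_ne (by omega), Function.update_of_ne (by omega)] at hr'

end OpenMeander

/-- For every `n ≥ 1`, `M^{Irr} (2n+32) ≥ M n` and
`M^{Irr} (2n+35) ≥ M n`. -/
theorem irrMeanderCount_ge_openMeanderCount (n : ℕ) (hn : 1 ≤ n) :
    irrMeanderCount (2 * n + 32) ≥ openMeanderCount n ∧
      irrMeanderCount (2 * n + 35) ≥ openMeanderCount n := by
  obtain ⟨c₁, p₁, i₁, j₁, h₁⟩ := OpenMeander.exists_isSeed_32
  obtain ⟨c₂, p₂, i₂, j₂, h₂⟩ := OpenMeander.exists_isSeed_34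
  obtain ⟨c₃, p₃, i₃, j₃, h₃⟩ := OpenMeander.exists_isSeed_35
  obtain ⟨c₄, p₄, i₄, j₄, h₄⟩ := OpenMeander.exists_isSeed_37
  rcases Nat.mod_two_eq_zero_or_one n with h | h
  · have hle := OpenMeander.openMeanderCount_le_succ h
    have h' : (n + 1) % 2 = 1 := by omega
    exact ⟨hle.trans (OpenMeander.openMeanderCount_le_irrMeanderCount h₁ h'),
      hle.trans (OpenMeander.openMeanderCount_le_irrMeanderCount h₃ h')⟩
  · exact ⟨OpenMeander.openMeanderCount_le_irrMeanderCount h₂ h,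
      OpenMeander.openMeanderCount_le_irrMeanderCount h₄ h⟩
end

section
/- Let n be an even positive integer and let (a_1,…,a_n) be an open meandric permutation of order n. Then the sequence (a_1+2, a_2+2, …, a_n+2, n+3, 2, 1) is a prime open meandric permutation of order n+3. -/
open Filter

theorem arcsCross_iff {p q r s : ℕ} : ArcsCross p q r s ↔
    (StrictlyBetween p q r ∧ ¬ StrictlyBetween p q s) ∨
      (StrictlyBetween p q s ∧ ¬ StrictlyBetween p q r) :=
  Iff.rfl

theorem sum_Ico_one_mod_two_of_pairs (f : ℕ → ℕ) {m : ℕ} (hm : 1 ≤ m)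
    (h : ∀ k, 1 ≤ k → k < m → f (2 * k) = f (2 * k + 1)) :
    (∑ i ∈ Finset.Ico 1 (2 * m), f i) % 2 = f 1 % 2 := by
  induction m, hm using Nat.le_induction with
  | base => simp
  | succ m hm ih =>
    have h1 := ih fun k hk hkm => h k hk (by omega)
    have h2 := h m hm (by omega)
    rw [show 2 * (m + 1) = 2 * m + 1 + 1 by ring, Finset.sum_Ico_succ_top (by omega),
      Finset.sum_Ico_succ_top (by omega)]
    omega

theorem sum_indicator_lt_of_perm {n : ℕ} {a : ℕ → ℕ}
    (hmem : ∀ i, 1 ≤ i → i ≤ n → 1 ≤ a i ∧ a i ≤ n)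
    (hinj : ∀ i j, 1 ≤ i → i ≤ n → 1 ≤ j → j ≤ n → a i = a j → i = j)
    {c : ℕ} (hc : c ≤ n + 1) :
    ∑ i ∈ Finset.Icc 1 n, (if a i < c then 1 else 0) = c - 1 := by
  have hinj' : Set.InjOn a (Finset.Icc 1 n : Finset ℕ) := by
    intro i hi j hj hij
    simp only [Finset.coe_Icc, Set.mem_Icc] at hi hj
    exact hinj i j hi.1 hi.2 hj.1 hj.2 hij
  have himage : (Finset.Icc 1 n).image a = Finset.Icc 1 n := by
    apply Finset.eq_of_subset_of_card_le
    · intro x hx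
      obtain ⟨i, hi, rfl⟩ := Finset.mem_image.mp hx
      rw [Finset.mem_Icc] at hi ⊢
      exact hmem i hi.1 hi.2
    · rw [Finset.card_image_of_injOn hinj']
  rw [← Finset.sum_image (f := fun x => if x < c then 1 else 0) hinj', himage,
    ← Finset.card_filter, show (Finset.Icc 1 n).filter (· < c) = Finset.Ico 1 c by
      ext x; simp only [Finset.mem_filter, Finset.mem_Icc, Finset.mem_Ico]; omega,
    Nat.card_Ico]

/-- The values below `a 1` other than `a n` are matched by lower arcs, so `a n < a 1` would give
`a 1` the wrong parity. -/
theorem IsOpenMeandricPerm.first_le_last {n : ℕ} {a : ℕ → ℕ} (ha : IsOpenMeandricPerm n a)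
    (hn : Even n) : a 1 ≤ a n := by
  obtain ⟨hn', hmem, hinj, hpar, -, -, hfirst, -⟩ := ha
  by_contra! hlt
  obtain ⟨m, hm⟩ := hn
  obtain rfl : n = 2 * m := by omega
  have hpairs := sum_Ico_one_mod_two_of_pairs (fun i => if a i < a 1 then 1 else 0)
    (m := m) (by omega) (by
      intro k hk hkm
      have h1 := hfirst (2 * k) (by simp) (by omega) (by omega)
      have h2 : a (2 * k) ≠ a 1 := fun h => by
        have := hinj _ _ (by omega) (by omega) (by omega) (by omega) h
        omega
      have h3 : a (2 * k + 1) ≠ a 1 := fun h => by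
        have := hinj _ _ (by omega) (by omega) (by omega) (by omega) h
        omega
      unfold StrictlyBetween at h1
      split_ifs <;> omega)
  have hcard := sum_indicator_lt_of_perm hmem hinj (c := a 1)
    (by have := hmem 1 (by omega) hn'; omega)
  rw [← Finset.Ico_add_one_right_eq_Icc, Finset.sum_Ico_succ_top (by omega), if_pos hlt] at hcard
  simp only [lt_irrefl, if_false] at hpairs
  have h1 := hpar 1 le_rfl hn'
  omega

/-- From an open meandric permutation of even order `n`, the
sequence `(a₁+2, …, aₙ+2, n+3, 2, 1)` is a prime open meandric permutation of
order `n + 3`. -/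
theorem prime_construction_even (n : ℕ) (hn : Even n) (hn' : 1 ≤ n) (a : ℕ → ℕ)
    (ha : IsOpenMeandricPerm n a) (b : ℕ → ℕ)
    (hb : ∀ i, b i =
      if i ≤ n then a i + 2
      else if i = n + 1 then n + 3
      else if i = n + 2 then 2
      else if i = n + 3 then 1
      else 0) :
    IsOpenMeandricPerm (n + 3) b ∧ IsPrimeMeander (n + 3) b := by
  have hle := ha.first_le_last hn
  obtain ⟨-, hmem, hinj, hpar, hupper, hlower, hfirst, hlast⟩ := ha
  rw [if_pos hn] at hlast
  have hnmod := Nat.even_iff.mp hn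
  have hold : ∀ i, i ≤ n → b i = a i + 2 := fun i hi => by rw [hb, if_pos hi]
  have hb1 : b (n + 1) = n + 3 := by rw [hb]; simp
  have hb2 : b (n + 2) = 2 := by rw [hb]; simp
  have hb3 : b (n + 3) = 1 := by rw [hb]; simp
  have hcases : ∀ i, 1 ≤ i → i ≤ n + 3 →
      (i ≤ n ∧ b i = a i + 2 ∧ 1 ≤ a i ∧ a i ≤ n ∧ a i % 2 = i % 2) ∨
      (i = n + 1 ∧ b i = n + 3) ∨ (i = n + 2 ∧ b i = 2) ∨ (i = n + 3 ∧ b i = 1) := by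
    intro i hi hin
    rcases (by omega : i ≤ n ∨ i = n + 1 ∨ i = n + 2 ∨ i = n + 3) with h | rfl | rfl | rfl
    · exact Or.inl ⟨h, hold i h, (hmem i hi h).1, (hmem i hi h).2, hpar i hi h⟩
    · exact Or.inr (Or.inl ⟨rfl, hb1⟩)
    · exact Or.inr (Or.inr (Or.inl ⟨rfl, hb2⟩))
    · exact Or.inr (Or.inr (Or.inr ⟨rfl, hb3⟩))
  have hupperCases : ∀ i, Odd i → i < n + 3 →
      (i < n ∧ b i = a i + 2 ∧ b (i + 1) = a (i + 1) + 2 ∧ 1 ≤ a i ∧ a i ≤ n ∧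
        1 ≤ a (i + 1) ∧ a (i + 1) ≤ n) ∨ (b i = n + 3 ∧ b (i + 1) = 2) := by
    intro i hi hin
    have := Nat.odd_iff.mp hi
    rcases (by omega : i < n ∨ i = n + 1) with h | rfl
    · have h1 := hmem i (by omega) h.le
      have h2 := hmem (i + 1) (by omega) h
      exact Or.inl ⟨h, hold _ h.le, hold _ h, h1.1, h1.2, h2.1, h2.2⟩
    · exact Or.inr ⟨hb1, hb2⟩
  have hlowerCases : ∀ i, Even i → 1 ≤ i → i < n + 3 →
      (i < n ∧ b i = a i + 2 ∧ b (i + 1) = a (i + 1) + 2 ∧ 1 ≤ a i ∧ a i ≤ n ∧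
        1 ≤ a (i + 1) ∧ a (i + 1) ≤ n ∧ a i ≠ a n ∧ a (i + 1) ≠ a n ∧
        ¬ StrictlyBetween (a i) (a (i + 1)) (a 1) ∧
        ¬ StrictlyBetween (a i) (a (i + 1)) (a n)) ∨
      (b i = a n + 2 ∧ b (i + 1) = n + 3) ∨ (b i = 2 ∧ b (i + 1) = 1) := by
    intro i hi hi1 hin
    have := Nat.even_iff.mp hi
    rcases (by omega : i + 1 < n ∨ i = n ∨ i = n + 2) with h | rfl | rfl
    · have h1 := hmem i (by omega) (by omega)
      have h2 := hmem (i + 1) (by omega) h.le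
      refine Or.inl ⟨by omega, hold _ (by omega), hold _ h.le, h1.1, h1.2, h2.1, h2.2,
        fun e => ?_, fun e => ?_, hfirst i hi hi1 (by omega), hlast i hi hi1 (by omega)⟩
      · have := hinj _ _ hi1 (by omega) hn' le_rfl e
        omega
      · have := hinj _ _ (by omega) h.le hn' le_rfl e
        omega
    · exact Or.inr (Or.inl ⟨hold _ le_rfl, hb1⟩)
    · exact Or.inr (Or.inr ⟨hb2, hb3⟩)
  have han := hmem n hn' le_rfl
  have ha1 := hmem 1 le_rfl hn'
  have hbfirst := hold 1 hn'
  refine ⟨⟨by omega, ?_, ?_, ?_, ?_, ?_, ?_, ?_⟩, ?_, ?_⟩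
  · intro i hi hin
    have := hcases i hi hin
    omega
  · intro i j hi hin hj hjn hij
    have h1 := hcases i hi hin
    have h2 := hcases j hj hjn
    by_cases h : i ≤ n ∧ j ≤ n
    · exact hinj i j hi h.1 hj h.2 (by omega)
    · omega
  · intro i hi hin
    have := hcases i hi hin
    omega
  · intro i j hi hin hj hjn
    have h0 := hupper i j hi
    have h1 := hupperCases i hi hin
    have h2 := hupperCases j hj hjn
    simp only [arcsCross_iff, StrictlyBetween] at h0 ⊢
    rcases h1 with h1 | h1 <;> rcases h2 with h2 | h2
    · have := h0 h1.1 hj h2.1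
      omega
    all_goals omega
  · intro i j hi hi1 hin hj hj1 hjn
    have h0 := hlower i j hi hi1
    have h1 := hlowerCases i hi hi1 hin
    have h2 := hlowerCases j hj hj1 hjn
    simp only [arcsCross_iff, StrictlyBetween] at h0 h1 h2 ⊢
    rcases h1 with h1 | h1 | h1 <;> rcases h2 with h2 | h2 | h2
    · have := h0 h1.1 hj hj1 h2.1
      omega
    all_goals omega
  · intro i hi hi1 hin
    have h1 := hlowerCases i hi hi1 hin
    simp only [StrictlyBetween] at h1 ⊢
    omega
  · rw [if_neg (by rw [Nat.even_iff]; omega)]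
    intro i hi hin
    have h1 := hupperCases i hi hin
    simp only [StrictlyBetween]
    omega
  · omega
  · rintro ⟨j, hj, hjn, h⟩
    have h1 : 1 ∈ (Finset.Icc 1 j).image b := by
      rw [h, Finset.mem_Icc]
      omega
    obtain ⟨i, hi, hbi⟩ := Finset.mem_image.mp h1
    rw [Finset.mem_Icc] at hi
    have := hcases i hi.1 (by omega)
    omega
end

section
/- Let n be an odd positive integer and let (a_1,…,a_n) be an open meandric permutation of order n. Then the sequence (a_1+2, a_2+2, …, a_n+2, 2, 1) is a prime open meandric permutation of order n+2. -/
open Filter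

theorem strictlyBetween_add_right (p q x c : ℕ) :
    StrictlyBetween (p + c) (q + c) (x + c) ↔ StrictlyBetween p q x := by
  unfold StrictlyBetween
  omega

theorem arcsCross_add_right (p q r s c : ℕ) :
    ArcsCross (p + c) (q + c) (r + c) (s + c) ↔ ArcsCross p q r s := by
  simp only [ArcsCross, strictlyBetween_add_right]

theorem not_arcsCross_iff (p q r s : ℕ) :
    ¬ ArcsCross p q r s ↔ (StrictlyBetween p q r ↔ StrictlyBetween p q s) := by
  change ¬ Xor _ _ ↔ _
  rw [xor_iff_not_iff, not_not]

/-- From an open meandric permutation of odd order `n`, the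
sequence `(a₁+2, …, aₙ+2, 2, 1)` is a prime open meandric permutation of
order `n + 2`. -/
theorem prime_construction_odd (n : ℕ) (hn : Odd n) (a : ℕ → ℕ)
    (ha : IsOpenMeandricPerm n a) (b : ℕ → ℕ)
    (hb : ∀ i, b i =
      if i ≤ n then a i + 2
      else if i = n + 1 then 2
      else if i = n + 2 then 1
      else 0) :
    IsOpenMeandricPerm (n + 2) b ∧ IsPrimeMeander (n + 2) b := by
  obtain ⟨m, rfl⟩ := hn
  obtain ⟨-, hrange, hinj, hpar, hup, hlow, hfirst, hlast⟩ := ha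
  have hne : ¬ Even (2 * m + 1) := by simp
  rw [if_neg hne] at hlast
  have hshift : ∀ i, i ≤ 2 * m + 1 → b i = a i + 2 := fun i hi => by rw [hb, if_pos hi]
  have htwo : b (2 * m + 2) = 2 := by simp [hb]
  have hone : b (2 * m + 3) = 1 := by simp [hb]
  have hcases : ∀ i, i ≤ 2 * m + 3 → i ≤ 2 * m + 1 ∨ i = 2 * m + 2 ∨ i = 2 * m + 3 := by
    omega
  refine ⟨⟨by omega, ?_, ?_, ?_, ?_, ?_, ?_, ?_⟩, ?_, ?_⟩
  · intro i h1 hi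
    rcases hcases i hi with h | rfl | rfl
    · have := hrange i h1 h
      rw [hshift i h]
      omega
    · omega
    · omega
  · intro i j hi1 hi hj1 hj hij
    rcases hcases i hi with h | rfl | rfl <;> rcases hcases j hj with h' | rfl | rfl
    · rw [hshift i h, hshift j h'] at hij
      exact hinj i j hi1 h hj1 h' (by omega)
    all_goals grind
  · intro i h1 hi
    rcases hcases i hi with h | rfl | rfl
    · have := hpar i h1 h
      rw [hshift i h]
      omega
    · omega
    · omega
  · rintro i j ⟨k, rfl⟩ hi ⟨l, rfl⟩ hj
    have hk : k < m ∨ k = m := by omega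
    have hl : l < m ∨ l = m := by omega
    rcases hk with hk | rfl <;> rcases hl with hl | rfl
    · rw [hshift _ (by omega), hshift _ (by omega), hshift _ (by omega), hshift _ (by omega),
        arcsCross_add_right]
      exact hup _ _ ⟨k, rfl⟩ (by omega) ⟨l, rfl⟩ (by omega)
    · have h := hlast (2 * k + 1) ⟨k, rfl⟩ (by omega)
      rw [hshift _ (by omega), hshift _ (by omega), hshift _ (by omega), htwo]
      rw [not_arcsCross_iff]
      unfold StrictlyBetween at *
      omega
    · have h := hlast (2 * l + 1) ⟨l, rfl⟩ (by omega)
      have h1 : a (2 * l + 1) ≠ a (2 * k + 1) := fun h => by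
        have := hinj _ _ (by omega) (by omega) (by omega) (by omega) h
        omega
      have h2 : a (2 * l + 1 + 1) ≠ a (2 * k + 1) := fun h => by
        have := hinj _ _ (by omega) (by omega) (by omega) (by omega) h
        omega
      have := hrange (2 * l + 1) (by omega) (by omega)
      have := hrange (2 * l + 1 + 1) (by omega) (by omega)
      rw [hshift (2 * k + 1) le_rfl, htwo, hshift _ (by omega), hshift _ (by omega)]
      rw [not_arcsCross_iff]
      unfold StrictlyBetween at *
      omega
    · rw [not_arcsCross_iff]
      unfold StrictlyBetween
      omega
  · rintro i j ⟨k, rfl⟩ hi1 hi ⟨l, rfl⟩ hj1 hj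
    have hk : k ≤ m ∨ k = m + 1 := by omega
    have hl : l ≤ m ∨ l = m + 1 := by omega
    have hlast_arc : b (m + 1 + (m + 1)) = 2 ∧ b (m + 1 + (m + 1) + 1) = 1 := by
      constructor
      · rw [← htwo]; congr 1; omega
      · rw [← hone]; congr 1; omega
    rcases hk with hk | rfl <;> rcases hl with hl | rfl
    · rw [hshift _ (by omega), hshift _ (by omega), hshift _ (by omega), hshift _ (by omega),
        arcsCross_add_right]
      exact hlow _ _ ⟨k, rfl⟩ hi1 (by omega) ⟨l, rfl⟩ hj1 (by omega)
    · rw [hshift _ (by omega), hshift _ (by omega), hlast_arc.1, hlast_arc.2]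
      rw [not_arcsCross_iff]
      unfold StrictlyBetween
      omega
    all_goals
      rw [hlast_arc.1, hlast_arc.2]
      rw [not_arcsCross_iff]
      unfold StrictlyBetween
      omega
  · rintro i ⟨k, rfl⟩ hi1 hi
    rw [hshift 1 (by omega)]
    by_cases hk : k ≤ m
    · rw [hshift _ (by omega), hshift _ (by omega), strictlyBetween_add_right]
      exact hfirst _ ⟨k, rfl⟩ hi1 (by omega)
    · obtain rfl : k = m + 1 := by omega
      rw [show m + 1 + (m + 1) = 2 * m + 2 by omega, htwo, hone]
      unfold StrictlyBetween
      omega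
  · rw [if_neg (by simp [Nat.even_add])]
    rintro i ⟨k, rfl⟩ hi
    rw [hone, hshift _ (by omega)]
    by_cases hk : k < m
    · rw [hshift _ (by omega)]
      unfold StrictlyBetween
      omega
    · obtain rfl : k = m := by omega
      rw [htwo]
      unfold StrictlyBetween
      omega
  · rw [hshift 1 (by omega)]
    omega
  · rintro ⟨j, hj2, hj, himage⟩
    have hmem : 1 ∈ (Finset.Icc 1 j).image b := by
      rw [himage, Finset.mem_Icc]
      omega
    obtain ⟨i, hi, hbi⟩ := Finset.mem_image.mp hmem
    rw [Finset.mem_Icc] at hi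
    rcases hcases i (by omega) with h | rfl | rfl
    · rw [hshift i h] at hbi
      omega
    · omega
    · omega
end

section
/- Let (a_1,…,a_p) and (b_1,…,b_q) be open meandric permutations of orders p and q respectively. Then their concatenation (a_1, …, a_p, p+b_1, …, p+b_q) is an open meandric permutation of order p+q. -/
open Filter

theorem isOpenMeandricPerm_iff (n : ℕ) (a : ℕ → ℕ) :
    IsOpenMeandricPerm n a ↔
      1 ≤ n ∧
      (∀ i, 1 ≤ i → i ≤ n → 1 ≤ a i ∧ a i ≤ n) ∧
      (∀ i j, 1 ≤ i → i ≤ n → 1 ≤ j → j ≤ n → a i = a j → i = j) ∧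
      (∀ i, 1 ≤ i → i ≤ n → a i % 2 = i % 2) ∧
      (∀ i j, i % 2 = j % 2 → 1 ≤ i → i < n → 1 ≤ j → j < n →
        ¬ ArcsCross (a i) (a (i + 1)) (a j) (a (j + 1))) ∧
      (∀ i, i % 2 = 0 → 1 ≤ i → i < n → ¬ StrictlyBetween (a i) (a (i + 1)) (a 1)) ∧
      (∀ i, i % 2 = n % 2 → 1 ≤ i → i < n → ¬ StrictlyBetween (a i) (a (i + 1)) (a n)) := by
  unfold IsOpenMeandricPerm
  simp only [Nat.even_iff, Nat.odd_iff]
  constructor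
  · rintro ⟨h1, h2, h3, h4, h5, h6, h7, h8⟩
    refine ⟨h1, h2, h3, h4, fun i j hij hi hi' hj hj' => ?_, h7, fun i hin hi hi' => ?_⟩
    · rcases Nat.mod_two_eq_zero_or_one i with h | h
      · exact h6 i j h hi hi' (hij ▸ h) hj hj'
      · exact h5 i j h hi' (hij ▸ h) hj'
    · split_ifs at h8 with h
      · exact h8 i (by omega) hi hi'
      · exact h8 i (by omega) hi'
  · rintro ⟨h1, h2, h3, h4, h5, h6, h7⟩
    refine ⟨h1, h2, h3, h4, fun i j hi hi' hj hj' => ?_, fun i j hi hi1 hi' hj hj1 hj' => ?_,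
      h6, ?_⟩
    · exact h5 i j (by omega) (by omega) hi' (by omega) hj'
    · exact h5 i j (by omega) hi1 hi' hj1 hj'
    · split_ifs with h
      · exact fun i hi hi1 hi' => h7 i (by omega) hi1 hi'
      · exact fun i hi hi' => h7 i (by omega) (by omega) hi'

theorem image_Icc_one_eq_of_injOn {n : ℕ} {a : ℕ → ℕ}
    (hmem : ∀ i, 1 ≤ i → i ≤ n → 1 ≤ a i ∧ a i ≤ n)
    (hinj : ∀ i j, 1 ≤ i → i ≤ n → 1 ≤ j → j ≤ n → a i = a j → i = j) :
    (Finset.Icc 1 n).image a = Finset.Icc 1 n := by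
  apply Finset.eq_of_subset_of_card_le
  · intro x hx
    simp only [Finset.mem_image, Finset.mem_Icc] at hx ⊢
    obtain ⟨i, hi, rfl⟩ := hx
    exact hmem i hi.1 hi.2
  · rw [Finset.card_image_of_injOn]
    intro i hi j hj hij
    simp only [Finset.coe_Icc, Set.mem_Icc] at hi hj
    exact hinj i j hi.1 hi.2 hj.1 hj.2 hij

theorem card_filter_lt_of_injOn {n : ℕ} {a : ℕ → ℕ}
    (hmem : ∀ i, 1 ≤ i → i ≤ n → 1 ≤ a i ∧ a i ≤ n)
    (hinj : ∀ i j, 1 ≤ i → i ≤ n → 1 ≤ j → j ≤ n → a i = a j → i = j)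
    {x : ℕ} (hx : x ≤ n) :
    ((Finset.Icc 1 n).filter (fun i => a i < x)).card = x - 1 := by
  have himage : ((Finset.Icc 1 n).filter (fun i => a i < x)).image a = Finset.Ico 1 x := by
    rw [← Finset.filter_image (p := (· < x)), image_Icc_one_eq_of_injOn hmem hinj]
    ext y
    simp only [Finset.mem_filter, Finset.mem_Icc, Finset.mem_Ico]
    omega
  rw [← Nat.card_Ico, ← himage, Finset.card_image_of_injOn]
  intro i hi j hj hij
  simp only [Finset.coe_filter, Finset.mem_Icc, Set.mem_ofPred_eq] at hi hj
  exact hinj i j hi.1.1 hi.1.2 hj.1.1 hj.1.2 hij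

/-- In an open meandric permutation of even order the first entry is smaller than the last:
the values below `a 1` other than `a n` are matched by the lower arcs, and their number
`a 1 - 1` is even. -/
theorem IsOpenMeandricPerm.first_lt_last {n : ℕ} {a : ℕ → ℕ} (h : IsOpenMeandricPerm n a)
    (hn : n % 2 = 0) : a 1 < a n := by
  obtain ⟨h1, hmem, hinj, hpar, -, hfirst, -⟩ := (isOpenMeandricPerm_iff n a).1 h
  have hstep : ∀ m, 1 ≤ m → 2 * m ≤ n →
      ((Finset.Icc 1 (2 * m)).filter (fun i => a i < a 1)).card % 2 =
        if a (2 * m) < a 1 then 1 else 0 := by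
    intro m hm
    induction m, hm using Nat.le_induction with
    | base =>
      intro _
      simp only [Finset.card_filter]
      rw [Finset.sum_Icc_succ_top (by omega)]
      simp only [Nat.mul_one, Nat.reduceAdd, Finset.Icc_self, Finset.sum_singleton, lt_irrefl,
        if_false]
      split_ifs <;> rfl
    | succ m hm ih =>
      intro hmn
      have hm' := ih (by omega)
      have hbetween := hfirst (2 * m) (by omega) (by omega) (by omega)
      have hne : a (2 * m) ≠ a 1 := fun e => by
        have := hinj _ _ (by omega) (by omega) le_rfl h1 e
        omega
      have hne' : a (2 * m + 1) ≠ a 1 := fun e => by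
        have := hinj _ _ (by omega) (by omega) le_rfl h1 e
        omega
      unfold StrictlyBetween at hbetween
      rw [show 2 * (m + 1) = 2 * m + 1 + 1 by ring]
      simp only [Finset.card_filter] at hm' ⊢
      rw [Finset.sum_Icc_succ_top (by omega), Finset.sum_Icc_succ_top (by omega)]
      split_ifs at hm' ⊢ <;> omega
  have hcount := hstep (n / 2) (by omega) (by omega)
  rw [show 2 * (n / 2) = n by omega, card_filter_lt_of_injOn hmem hinj (hmem 1 le_rfl h1).2]
    at hcount
  have hodd := hpar 1 le_rfl h1
  have hpos := hmem 1 le_rfl h1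
  have hne : a 1 ≠ a n := fun e => by
    have := hinj _ _ le_rfl h1 h1 le_rfl e
    omega
  split_ifs at hcount <;> omega

theorem arcsCross_iff_s18 {x y u v : ℕ} :
    ArcsCross x y u v ↔ StrictlyBetween x y u ∧ ¬ StrictlyBetween x y v ∨
      StrictlyBetween x y v ∧ ¬ StrictlyBetween x y u :=
  Iff.rfl

theorem not_arcsCross_of_separated {k x y u v : ℕ} (hx : x ≤ k) (hy : y ≤ k)
    (hu : k < u) (hv : k < v) : ¬ ArcsCross x y u v ∧ ¬ ArcsCross u v x y := by
  simp only [arcsCross_iff_s18, StrictlyBetween]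
  omega

theorem strictlyBetween_add_left {k x y u : ℕ} :
    StrictlyBetween (k + x) (k + y) (k + u) ↔ StrictlyBetween x y u := by
  unfold StrictlyBetween
  omega

theorem arcsCross_add_left {k x y u v : ℕ} :
    ArcsCross (k + x) (k + y) (k + u) (k + v) ↔ ArcsCross x y u v := by
  simp only [arcsCross_iff_s18, strictlyBetween_add_left]

/-- An arc below `k` not enclosing `u` does not cross an arc joining `u` to a point above `k`. -/
theorem not_arcsCross_bridge_of_le {k x y u v : ℕ} (hx : x ≤ k) (hy : y ≤ k) (hv : k < v)
    (hxu : x ≠ u) (hyu : y ≠ u) (h : ¬ StrictlyBetween x y u) :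
    ¬ ArcsCross x y u v ∧ ¬ ArcsCross u v x y := by
  unfold StrictlyBetween at h
  simp only [arcsCross_iff_s18, StrictlyBetween]
  omega

/-- An arc above `k` not enclosing `v` does not cross an arc joining `v` to a point up to `k`. -/
theorem not_arcsCross_bridge_of_lt {k x y u v : ℕ} (hx : k < x) (hy : k < y) (hu : u ≤ k)
    (hxv : x ≠ v) (hyv : y ≠ v) (h : ¬ StrictlyBetween x y v) :
    ¬ ArcsCross x y u v ∧ ¬ ArcsCross u v x y := by
  unfold StrictlyBetween at h
  simp only [arcsCross_iff_s18, StrictlyBetween]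
  omega

theorem not_arcsCross_self (x y : ℕ) : ¬ ArcsCross x y x y := by
  simp only [arcsCross_iff_s18, StrictlyBetween]
  omega

/-- The concatenation of open meandric permutations of orders `p`
and `q` is an open meandric permutation of order `p + q`. -/
theorem concat_isOpenMeandricPerm (p q : ℕ) (a b : ℕ → ℕ)
    (ha : IsOpenMeandricPerm p a) (hb : IsOpenMeandricPerm q b) (c : ℕ → ℕ)
    (hc : ∀ i, c i = if i ≤ p then a i else p + b (i - p)) :
    IsOpenMeandricPerm (p + q) c := by
  have hlast_a := ha.first_lt_last
  have hlast_b := hb.first_lt_last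
  rw [isOpenMeandricPerm_iff] at ha hb ⊢
  obtain ⟨hp, amem, ainj, apar, across, afirst, alast⟩ := ha
  obtain ⟨hq, bmem, binj, bpar, bcross, bfirst, blast⟩ := hb
  have hca : ∀ i, i ≤ p → c i = a i := fun i hi => by rw [hc, if_pos hi]
  have hcb : ∀ j, 1 ≤ j → c (p + j) = p + b j := fun j hj => by
    rw [hc, if_neg (by omega), Nat.add_sub_cancel_left]
  have hcases : ∀ i, 1 ≤ i → i ≤ p + q →
      i ≤ p ∨ ∃ j, 1 ≤ j ∧ j ≤ q ∧ i = p + j := fun i hi hi' => by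
    rcases Nat.lt_or_ge p i with h | h
    · exact Or.inr ⟨i - p, by omega, by omega, by omega⟩
    · exact Or.inl h
  have harcs : ∀ i, 1 ≤ i → i < p + q →
      i < p ∨ i = p ∨ ∃ j, 1 ≤ j ∧ j < q ∧ i = p + j := fun i hi hi' => by
    rcases Nat.lt_trichotomy p i with h | h | h
    · exact Or.inr (Or.inr ⟨i - p, by omega, by omega, by omega⟩)
    · exact Or.inr (Or.inl h.symm)
    · exact Or.inl h
  have hbridge_a : ∀ i, i % 2 = p % 2 → 1 ≤ i → i < p →
      ¬ ArcsCross (a i) (a (i + 1)) (a p) (p + b 1) ∧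
      ¬ ArcsCross (a p) (p + b 1) (a i) (a (i + 1)) := fun i hip hi hi' => by
    have hb1 := bmem 1 le_rfl hq
    refine not_arcsCross_bridge_of_le (amem i hi hi'.le).2 (amem (i + 1) (by omega) hi').2
      (by omega) (fun e => ?_) (fun e => ?_) (alast i hip hi hi')
    · have := ainj _ _ hi hi'.le hp le_rfl e
      omega
    · have := ainj _ _ (by omega) hi' hp le_rfl e
      omega
  have hbridge_b : ∀ j, j % 2 = 0 → 1 ≤ j → j < q →
      ¬ ArcsCross (p + b j) (p + b (j + 1)) (a p) (p + b 1) ∧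
      ¬ ArcsCross (a p) (p + b 1) (p + b j) (p + b (j + 1)) := fun j hj0 hj hj' => by
    have hb1 := bmem j hj hj'.le
    have hb2 := bmem (j + 1) (by omega) hj'
    refine not_arcsCross_bridge_of_lt (k := p) (by omega) (by omega) (amem p hp le_rfl).2
      (fun e => ?_) (fun e => ?_) (strictlyBetween_add_left.not.2 (bfirst j hj0 hj hj'))
    · have := binj _ _ hj hj'.le le_rfl hq (Nat.add_left_cancel e)
      omega
    · have := binj _ _ (by omega) hj' le_rfl hq (Nat.add_left_cancel e)
      omega
  have hsep : ∀ i j, 1 ≤ i → i < p → 1 ≤ j → j < q →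
      ¬ ArcsCross (a i) (a (i + 1)) (p + b j) (p + b (j + 1)) ∧
      ¬ ArcsCross (p + b j) (p + b (j + 1)) (a i) (a (i + 1)) := fun i j hi hi' hj hj' => by
    have hb1 := bmem j hj hj'.le
    have hb2 := bmem (j + 1) (by omega) hj'
    exact not_arcsCross_of_separated (amem i hi hi'.le).2 (amem (i + 1) (by omega) hi').2
      (by omega) (by omega)
  refine ⟨by omega, fun i hi hi' => ?_, fun i j hi hi' hj hj' hij => ?_, fun i hi hi' => ?_,
    fun i j hij hi hi' hj hj' => ?_, fun i hi0 hi hi' => ?_, fun i hin hi hi' => ?_⟩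
  · rcases hcases i hi hi' with h | ⟨k, hk, hk', rfl⟩
    · rw [hca i h]
      have := amem i hi h
      omega
    · rw [hcb k hk]
      have := bmem k hk hk'
      omega
  · rcases hcases i hi hi' with h | ⟨k, hk, hk', rfl⟩ <;>
      rcases hcases j hj hj' with g | ⟨l, hl, hl', rfl⟩
    · rw [hca i h, hca j g] at hij
      exact ainj i j hi h hj g hij
    · rw [hca i h, hcb l hl] at hij
      have := amem i hi h
      have := bmem l hl hl'
      omega
    · rw [hcb k hk, hca j g] at hij
      have := amem j hj g
      have := bmem k hk hk'
      omega
    · rw [hcb k hk, hcb l hl] at hij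
      rw [binj k l hk hk' hl hl' (Nat.add_left_cancel hij)]
  · rcases hcases i hi hi' with h | ⟨k, hk, hk', rfl⟩
    · rw [hca i h]
      exact apar i hi h
    · rw [hcb k hk]
      have := bpar k hk hk'
      omega
  · rcases harcs i hi hi' with h | rfl | ⟨k, hk, hk', rfl⟩ <;>
      rcases harcs j hj hj' with g | g | ⟨l, hl, hl', rfl⟩
    · rw [hca i h.le, hca (i + 1) h, hca j g.le, hca (j + 1) g]
      exact across i j hij hi h hj g
    · subst g
      rw [hca i h.le, hca (i + 1) h, hca j le_rfl, hcb 1 le_rfl]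
      exact (hbridge_a i hij hi h).1
    · rw [hca i h.le, hca (i + 1) h, hcb l hl, add_assoc, hcb _ (by omega)]
      exact (hsep i l hi h hl hl').1
    · rw [hca i le_rfl, hcb 1 le_rfl, hca j g.le, hca (j + 1) g]
      exact (hbridge_a j hij.symm hj g).2
    · rw [g]
      exact not_arcsCross_self _ _
    · rw [hca i le_rfl, hcb 1 le_rfl, hcb l hl, add_assoc, hcb _ (by omega)]
      exact (hbridge_b l (by omega) hl hl').2
    · rw [hca j g.le, hca (j + 1) g, hcb k hk, add_assoc, hcb _ (by omega)]
      exact (hsep j k hj g hk hk').2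
    · subst g
      rw [hca j le_rfl, hcb 1 le_rfl, hcb k hk, add_assoc, hcb _ (by omega)]
      exact (hbridge_b k (by omega) hk hk').1
    · rw [hcb k hk, hcb l hl, add_assoc, hcb _ (by omega), add_assoc, hcb _ (by omega),
        arcsCross_add_left]
      exact bcross k l (by omega) hk hk' hl hl'
  · rw [hca 1 hp]
    rcases harcs i hi hi' with h | rfl | ⟨k, hk, hk', rfl⟩
    · rw [hca i h.le, hca (i + 1) h]
      exact afirst i hi0 hi h
    · rw [hca i le_rfl, hcb 1 le_rfl]
      have := hlast_a hi0
      unfold StrictlyBetween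
      have := bmem 1 le_rfl hq
      have := amem i hp le_rfl
      omega
    · rw [hcb k hk, add_assoc, hcb _ (by omega)]
      have := bmem k hk hk'.le
      have := bmem (k + 1) (by omega) hk'
      have := amem 1 le_rfl hp
      unfold StrictlyBetween
      omega
  · rw [hcb q hq]
    rcases harcs i hi hi' with h | rfl | ⟨k, hk, hk', rfl⟩
    · rw [hca i h.le, hca (i + 1) h]
      have := amem i hi h.le
      have := amem (i + 1) (by omega) h
      unfold StrictlyBetween
      omega
    · rw [hca i le_rfl, hcb 1 le_rfl]
      have := hlast_b (by omega)
      unfold StrictlyBetween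
      have := amem i hp le_rfl
      omega
    · rw [hcb k hk, add_assoc, hcb _ (by omega), strictlyBetween_add_left]
      exact blast k (by omega) hk hk'
end
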